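/- arXiv:1509.08859 — 2 statements merged into one kernel-verified Lean document; each statement's English description precedes it below -/
import Mathlib

section
/- Let p₁, p₂, p₃, p₄ and q₁, q₂, q₃, q₄ be two quadruples of points in EuclideanSpace ℝ (Fin 3), all of norm 1, such that within each quadruple all pairwise distances are equal (so each quadruple is the vertex set of a regular tetrahedron inscribed in the unit sphere). Then the volume of the convex hull of the eight points satisfies vol(convexHull ℝ {p₁,…,p₄,q₁,…,q₄}) ≤ 8/(3√3), the volume of a cube inscribed in the unit sphere. -/
open MeasureTheory Real


def D4 (A B C X : Fin 3 → ℝ) : ℝ :=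
  (B 0 - A 0) * ((C 1 - A 1) * (X 2 - A 2) - (C 2 - A 2) * (X 1 - A 1))
  - (B 1 - A 1) * ((C 0 - A 0) * (X 2 - A 2) - (C 2 - A 2) * (X 0 - A 0))
  + (B 2 - A 2) * ((C 0 - A 0) * (X 1 - A 1) - (C 1 - A 1) * (X 0 - A 0))

/-- open corner simplex -/
def cornerO : Set (Fin 3 → ℝ) := {x | 0 < x 0 ∧ 0 < x 1 ∧ 0 < x 2 ∧ x 0 + x 1 + x 2 < 1}
def corner : Set (Fin 3 → ℝ) := {x | 0 ≤ x 0 ∧ 0 ≤ x 1 ∧ 0 ≤ x 2 ∧ x 0 + x 1 + x 2 ≤ 1}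

lemma measurableSet_cornerO : MeasurableSet cornerO := by
  apply IsOpen.measurableSet
  unfold cornerO
  refine IsOpen.and (isOpen_lt (by fun_prop) (by fun_prop)) (IsOpen.and (isOpen_lt (by fun_prop) (by fun_prop)) (IsOpen.and (isOpen_lt (by fun_prop) (by fun_prop)) (isOpen_lt (by fun_prop) (by fun_prop))))

/-- sign of a Boolean -/
def sg (b : Bool) : ℝ := if b then 1 else -1

lemma vol_cornerO : volume cornerO ≤ ENNReal.ofReal (1/6) := by
  have hoct := MeasureTheory.volume_sum_rpow_lt_one (Fin 3) (p := 1) le_rfl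
  have hG : Real.Gamma ((Fintype.card (Fin 3) : ℝ) / 1 + 1) = 6 := by
    have := Real.Gamma_nat_eq_factorial 3
    norm_num [Nat.factorial] at this ⊢
  rw [hG] at hoct
  have hG2 : Real.Gamma (1 / 1 + 1) = 1 := by
    norm_num [Real.Gamma_two]
  rw [hG2] at hoct
  simp only [Real.rpow_one] at hoct
  let f : (Fin 3 → Bool) → Set (Fin 3 → ℝ) := fun s => {x | (fun i => sg (s i) * x i) ∈ cornerO}
  have hf : ∀ s, volume (f s) = volume cornerO := by
    intro s
    have h2 := MeasureTheory.Measure.addHaar_preimage_linearMap (volume : Measure (Fin 3 → ℝ))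
      (f := Matrix.toLin' (Matrix.diagonal fun i => sg (s i))) (by
        rw [LinearMap.det_toLin', Matrix.det_diagonal]
        apply Finset.prod_ne_zero_iff.2
        intro i _; unfold sg; split_ifs <;> norm_num) cornerO
    rw [LinearMap.det_toLin', Matrix.det_diagonal] at h2
    have h3 : |(∏ i, sg (s i))⁻¹| = 1 := by
      rw [abs_inv, Finset.abs_prod]
      have : ∀ i, |sg (s i)| = 1 := by intro i; unfold sg; split_ifs <;> norm_num
      simp [this]
    rw [h3] at h2
    simp only [ENNReal.ofReal_one, one_mul] at h2
    rw [← h2]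
    congr 1
    ext x
    simp only [f, Set.mem_ofPred_eq, Set.mem_preimage, Matrix.toLin'_apply]
    have : (fun i => sg (s i) * x i) = (Matrix.diagonal fun i => sg (s i)).mulVec x := by
      ext i; simp [Matrix.mulVec_diagonal]
    rw [this]
  have hm : ∀ s, MeasurableSet (f s) := by
    intro s
    exact measurableSet_cornerO.preimage (by fun_prop)
  have hd : Pairwise (Function.onFun Disjoint f) := by
    intro s t hst
    rw [Function.onFun, Set.disjoint_left]
    intro x hx hy
    apply hst
    simp only [f, cornerO, Set.mem_ofPred_eq] at hx hy
    have key : ∀ b c : Bool, ∀ y : ℝ, 0 < sg b * y → 0 < sg c * y → b = c := by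
      intro b c y h1 h2
      cases b <;> cases c <;> simp [sg] at * <;> linarith
    ext i
    fin_cases i
    · simpa using key _ _ _ hx.1 hy.1
    · simpa using key _ _ _ hx.2.1 hy.2.1
    · simpa using key _ _ _ hx.2.2.1 hy.2.2.1
  have hU := measure_iUnion (μ := volume) hd hm
  simp only [hf, tsum_fintype, Finset.sum_const, Finset.card_univ] at hU
  have hsub : (⋃ s, f s) ⊆ {x : Fin 3 → ℝ | ∑ i, |x i| < 1} := by
    intro x hx
    simp only [Set.mem_iUnion, f, cornerO, Set.mem_ofPred_eq] at hx
    obtain ⟨s, h0, h1, h2, h3⟩ := hx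
    have key : ∀ b : Bool, ∀ y : ℝ, 0 < sg b * y → |y| = sg b * y := by
      intro b y h
      cases b <;> simp [sg] at *
      · exact h.le
      · exact h.le
    simp only [Set.mem_ofPred_eq, Fin.sum_univ_three]
    rw [key _ _ h0, key _ _ h1, key _ _ h2]; exact h3
  have := measure_mono (μ := volume) hsub
  rw [hU, hoct] at this
  simp only [nsmul_eq_mul] at this
  have hc : ((Fintype.card (Fin 3 → Bool) : ℕ) : ENNReal) = ENNReal.ofReal 8 := by
    simp
  rw [hc] at this
  have h8 : ENNReal.ofReal ((2 * 1) ^ Fintype.card (Fin 3) / 6) = ENNReal.ofReal 8 * ENNReal.ofReal (1/6) := by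
    rw [← ENNReal.ofReal_mul (by norm_num)]; congr 1; norm_num
  rw [h8] at this
  exact (ENNReal.mul_le_mul_iff_right (by simp) (by simp)).1 this

lemma vol_corner : volume corner ≤ ENNReal.ofReal (1/6) := by
  have hc : Convex ℝ cornerO := by
    intro x hx y hy s t hs ht hst
    simp only [cornerO, Set.mem_ofPred_eq, Pi.add_apply, Pi.smul_apply, smul_eq_mul] at *
    rcases hs.eq_or_lt with h | h
    · subst h; simp at hst; subst hst; simpa using hy
    · obtain ⟨a1, a2, a3, a4⟩ := hx
      obtain ⟨b1, b2, b3, b4⟩ := hy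
      refine ⟨by positivity, by positivity, by positivity, by nlinarith⟩
  have h1 := hc.addHaar_frontier volume
  have h2 : corner ⊆ closure cornerO := by
    intro x hx
    obtain ⟨a1, a2, a3, a4⟩ := hx
    rw [mem_closure_iff_seq_limit]
    refine ⟨fun n => fun i => (1 - 1/((n:ℝ)+2)) * x i + (1/((n:ℝ)+2)) * (1/4), ?_, ?_⟩
    · intro n
      have hp : 0 < 1/((n:ℝ)+2) := by positivity
      have hq : 0 < 1 - 1/((n:ℝ)+2) := by
        rw [sub_pos, div_lt_one (by positivity)]; linarith [(Nat.cast_nonneg n : (0:ℝ) ≤ n)]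
      refine ⟨by positivity, by positivity, by positivity, ?_⟩
      simp only
      nlinarith
    · rw [tendsto_pi_nhds]
      intro i
      have : Filter.Tendsto (fun n : ℕ => 1/((n:ℝ)+2)) Filter.atTop (nhds 0) := by
        have := (tendsto_one_div_add_atTop_nhds_zero_nat (𝕜 := ℝ)).comp (Filter.tendsto_add_atTop_nat 1)
        refine this.congr ?_
        intro n; simp; ring
      have h := ((this.const_sub 1).mul_const (x i)).add (this.mul_const (1/4))
      simpa using h
  calc volume corner ≤ volume (closure cornerO) := measure_mono h2
    _ ≤ volume (cornerO ∪ frontier cornerO) := measure_mono (by rw [closure_eq_self_union_frontier])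
    _ ≤ volume cornerO + volume (frontier cornerO) := measure_union_le _ _
    _ ≤ ENNReal.ofReal (1/6) := by rw [h1, add_zero]; exact vol_cornerO

/-- The tetrahedron with vertices `A B C X`, as an affine image of the corner simplex. -/
def tet (A B C X : Fin 3 → ℝ) : Set (Fin 3 → ℝ) :=
  (fun y => A + y) '' ((Matrix.toLin' (Matrix.of fun i j => (![B, C, X] j i - A i))) '' corner)

lemma vol_tet (A B C X : Fin 3 → ℝ) (h : 0 ≤ D4 A B C X) :
    volume (tet A B C X) ≤ ENNReal.ofReal (D4 A B C X / 6) := by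
  unfold tet
  rw [Set.image_add_left, measure_preimage_add, Measure.addHaar_image_linearMap, LinearMap.det_toLin']
  have : Matrix.det (Matrix.of fun i j => (![B, C, X] j i - A i)) = D4 A B C X := by
    rw [Matrix.det_fin_three]; simp [D4]; ring
  rw [this, abs_of_nonneg h, div_eq_mul_one_div, ENNReal.ofReal_mul h]
  gcongr
  exact vol_corner

lemma mem_tet (A B C X x : Fin 3 → ℝ) (h : 0 < D4 A B C X)
    (h0 : 0 ≤ D4 x B C X) (h1 : 0 ≤ D4 A x C X) (h2 : 0 ≤ D4 A B x X) (h3 : 0 ≤ D4 A B C x) :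
    x ∈ tet A B C X := by
  refine ⟨x - A, ⟨![D4 A x C X / D4 A B C X, D4 A B x X / D4 A B C X, D4 A B C x / D4 A B C X], ?_, ?_⟩, by simp⟩
  · refine ⟨by simp; positivity, by simp; positivity, by simp; positivity, ?_⟩
    have : D4 A x C X + D4 A B x X + D4 A B C x + D4 x B C X = D4 A B C X := by
      unfold D4; ring
    simp only [Matrix.cons_val]
    rw [← add_div, ← add_div, div_le_one h]
    linarith
  · have hD := h.ne'
    ext i
    simp only [Matrix.toLin'_apply, Matrix.mulVec, dotProduct, Fin.sum_univ_three, Matrix.of_apply, Matrix.cons_val, Pi.sub_apply]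
    have : ∀ i, (B i - A i) * D4 A x C X + (C i - A i) * D4 A B x X + (X i - A i) * D4 A B C x = (x i - A i) * D4 A B C X := by
      intro i
      fin_cases i <;> simp [D4] <;> ring
    have := this i
    field_simp
    linarith


lemma D4_affine (A B C x y : Fin 3 → ℝ) (s t : ℝ) (h : s + t = 1) :
    D4 A B C (s • x + t • y) = s * D4 A B C x + t * D4 A B C y := by
  obtain rfl : t = 1 - s := by linarith
  simp only [D4, Pi.add_apply, Pi.smul_apply, smul_eq_mul]
  ring

lemma D4_nonneg_of_mem {A B C : Fin 3 → ℝ} {S : Set (Fin 3 → ℝ)} (h : ∀ w ∈ S, 0 ≤ D4 A B C w)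
    {x : Fin 3 → ℝ} (hx : x ∈ convexHull ℝ S) : 0 ≤ D4 A B C x := by
  have hc : Convex ℝ {w | 0 ≤ D4 A B C w} := by
    intro u hu v hv s t hs ht hst
    simp only [Set.mem_ofPred_eq] at *
    rw [D4_affine _ _ _ _ _ _ _ hst]
    positivity
  exact convexHull_min (t := {w | 0 ≤ D4 A B C w}) h hc hx

/-- Plücker relation in the quotient by the line `PQ`. -/
lemma D4_plucker (P Q A B C x : Fin 3 → ℝ) :
    D4 P Q B C * D4 P Q A x + D4 P Q A B * D4 P Q C x = D4 P Q A C * D4 P Q B x := by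
  unfold D4
  generalize Q 0 - P 0 = u0
  generalize Q 1 - P 1 = u1
  generalize Q 2 - P 2 = u2
  generalize A 0 - P 0 = a0
  generalize A 1 - P 1 = a1
  generalize A 2 - P 2 = a2
  generalize B 0 - P 0 = b0
  generalize B 1 - P 1 = b1
  generalize B 2 - P 2 = b2
  generalize C 0 - P 0 = c0
  generalize C 1 - P 1 = c1
  generalize C 2 - P 2 = c2
  generalize x 0 - P 0 = x0
  generalize x 1 - P 1 = x1
  generalize x 2 - P 2 = x2
  ring

lemma D4_swap34 (A B C X : Fin 3 → ℝ) : D4 A B X C = - D4 A B C X := by unfold D4; ring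

/-- Four half-planes around an axis cover everything. -/
lemma fan_cover (P Q A B C E x : Fin 3 → ℝ) (hAB : 0 < D4 P Q A B) (hBC : 0 < D4 P Q B C)
    (hCE : 0 < D4 P Q C E) (hEA : 0 < D4 P Q E A) :
    (0 ≤ D4 P Q A x ∧ D4 P Q B x ≤ 0) ∨ (0 ≤ D4 P Q B x ∧ D4 P Q C x ≤ 0) ∨
    (0 ≤ D4 P Q C x ∧ D4 P Q E x ≤ 0) ∨ (0 ≤ D4 P Q E x ∧ D4 P Q A x ≤ 0) := by
  have r1 := D4_plucker P Q A B C x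
  have r2 := D4_plucker P Q C E A x
  rw [D4_swap34 P Q A C] at r2
  by_contra! hcon
  obtain ⟨h1, h2, h3, h4⟩ := hcon
  rcases le_or_gt 0 (D4 P Q A x) with hA | hA
  · have hB := h1 hA
    have hC := h2 hB.le
    have hE := h3 hC.le
    have hA' := h4 hE.le
    have k1 : 0 < D4 P Q A C * D4 P Q B x := by rw [← r1]; positivity
    have k2 : 0 < -D4 P Q A C * D4 P Q E x := by rw [← r2]; positivity
    have := (pos_iff_pos_of_mul_pos k1).2 hB
    nlinarith
  · have hE : D4 P Q E x < 0 := by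
      by_contra! h; exact absurd (h4 h) (by linarith)
    have hC : D4 P Q C x < 0 := by
      by_contra! h; exact absurd (h3 h) (by linarith)
    have hB : D4 P Q B x < 0 := by
      by_contra! h; exact absurd (h2 h) (by linarith)
    have k1 : D4 P Q A C * D4 P Q B x < 0 := by rw [← r1]; nlinarith
    have k2 : -D4 P Q A C * D4 P Q E x < 0 := by rw [← r2]; nlinarith
    have : 0 < D4 P Q A C := by
      by_contra! h; nlinarith
    nlinarith

/-- The decomposition of the hull of eight points into six tetrahedra. -/
lemma hull_subset_tets (P1 P2 P3 P4 Q1 Q2 Q3 Q4 : Fin 3 → ℝ) (S : Set (Fin 3 → ℝ))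
    (t1 : 0 < D4 P2 Q2 P3 P4) (t2 : 0 < D4 P2 Q2 P4 Q3) (t3 : 0 < D4 P2 Q2 Q3 Q4)
    (t4 : 0 < D4 P2 Q2 Q4 P3) (t5 : 0 < D4 Q1 P2 P3 P4) (t6 : 0 < D4 P1 Q2 Q4 Q3)
    (l1 : ∀ w ∈ S, 0 ≤ D4 Q2 P4 P3 w) (l2 : ∀ w ∈ S, 0 ≤ D4 Q2 Q3 P4 w)
    (l3 : ∀ w ∈ S, 0 ≤ D4 P2 P4 Q3 w) (l4 : ∀ w ∈ S, 0 ≤ D4 P2 Q3 Q4 w)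
    (l5 : ∀ w ∈ S, 0 ≤ D4 Q2 P3 Q4 w) (l6 : ∀ w ∈ S, 0 ≤ D4 P2 Q4 P3 w)
    (c1 : ∀ w ∈ S, 0 ≤ D4 Q1 P3 P4 w) (c2 : ∀ w ∈ S, 0 ≤ D4 Q1 P4 P2 w)
    (c3 : ∀ w ∈ S, 0 ≤ D4 Q1 P2 P3 w)
    (d1 : ∀ w ∈ S, 0 ≤ D4 P1 Q4 Q3 w) (d2 : ∀ w ∈ S, 0 ≤ D4 P1 Q3 Q2 w)
    (d3 : ∀ w ∈ S, 0 ≤ D4 P1 Q2 Q4 w) :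
    convexHull ℝ S ⊆ tet P2 Q2 P3 P4 ∪ tet P2 Q2 P4 Q3 ∪ tet P2 Q2 Q3 Q4 ∪ tet P2 Q2 Q4 P3
      ∪ tet Q1 P2 P3 P4 ∪ tet P1 Q2 Q4 Q3 := by
  intro x hx
  replace l1 := D4_nonneg_of_mem l1 hx
  replace l2 := D4_nonneg_of_mem l2 hx
  replace l3 := D4_nonneg_of_mem l3 hx
  replace l4 := D4_nonneg_of_mem l4 hx
  replace l5 := D4_nonneg_of_mem l5 hx
  replace l6 := D4_nonneg_of_mem l6 hx
  replace c1 := D4_nonneg_of_mem c1 hx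
  replace c2 := D4_nonneg_of_mem c2 hx
  replace c3 := D4_nonneg_of_mem c3 hx
  replace d1 := D4_nonneg_of_mem d1 hx
  replace d2 := D4_nonneg_of_mem d2 hx
  replace d3 := D4_nonneg_of_mem d3 hx
  have e1 : ∀ A B C X : Fin 3 → ℝ, D4 X A B C = D4 A C B X := by intros; unfold D4; ring
  have e2 : ∀ A B C X : Fin 3 → ℝ, D4 A X B C = D4 A B C X := by intros; unfold D4; ring
  have e3 : ∀ A B C X : Fin 3 → ℝ, D4 A B X C = D4 A C B X := by intros; unfold D4; ring
  have e4 : ∀ A B C X : Fin 3 → ℝ, D4 A B C X = - D4 A C B X := by intros; unfold D4; ring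
  rcases le_or_gt 0 (D4 P2 P4 P3 x) with hcP | hcP
  · refine Or.inl (Or.inr (mem_tet _ _ _ _ _ t5 ?_ ?_ ?_ ?_))
    · rw [e1]; exact hcP
    · rw [e2]; exact c1
    · rw [e3]; exact c2
    · exact c3
  rcases le_or_gt 0 (D4 Q2 Q3 Q4 x) with hcQ | hcQ
  · refine Or.inr (mem_tet _ _ _ _ _ t6 ?_ ?_ ?_ ?_)
    · rw [e1]; exact hcQ
    · rw [e2]; exact d1
    · rw [e3]; exact d2
    · exact d3
  rcases fan_cover P2 Q2 P3 P4 Q3 Q4 x t1 t2 t3 t4 with ⟨u, v⟩ | ⟨u, v⟩ | ⟨u, v⟩ | ⟨u, v⟩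
  · refine Or.inl (Or.inl (Or.inl (Or.inl (Or.inl (mem_tet _ _ _ _ _ t1 ?_ ?_ ?_ u)))))
    · rw [e1]; exact l1
    · rw [e2, e4]; linarith
    · rw [D4_swap34]; linarith
  · refine Or.inl (Or.inl (Or.inl (Or.inl (Or.inr (mem_tet _ _ _ _ _ t2 ?_ ?_ ?_ u)))))
    · rw [e1]; exact l2
    · rw [e2]; exact l3
    · rw [D4_swap34]; linarith
  · refine Or.inl (Or.inl (Or.inl (Or.inr (mem_tet _ _ _ _ _ t3 ?_ ?_ ?_ u))))
    · rw [e1, e4]; linarith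
    · rw [e2]; exact l4
    · rw [D4_swap34]; linarith
  · refine Or.inl (Or.inl (Or.inr (mem_tet _ _ _ _ _ t4 ?_ ?_ ?_ u)))
    · rw [e1]; exact l5
    · rw [e2]; exact l6
    · rw [D4_swap34]; linarith


/-- squared norm of the quaternion `(a,b,c,d)` -/
def nrm (a b c d : ℝ) : ℝ := a ^ 2 + b ^ 2 + c ^ 2 + d ^ 2

/-- (unnormalised) rotation matrix of the quaternion `(a,b,c,d)` -/
def rot (a b c d : ℝ) : Matrix (Fin 3) (Fin 3) ℝ :=
  !![a ^ 2 + b ^ 2 - c ^ 2 - d ^ 2, 2 * (b * c - a * d), 2 * (b * d + a * c);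
     2 * (b * c + a * d), a ^ 2 - b ^ 2 + c ^ 2 - d ^ 2, 2 * (c * d - a * b);
     2 * (b * d - a * c), 2 * (c * d + a * b), a ^ 2 - b ^ 2 - c ^ 2 + d ^ 2]

/-- vertices of the standard tetrahedron (alternate vertices of the cube `[-1,1]^3`) -/
def W : Fin 4 → Fin 3 → ℝ := ![![1, 1, 1], ![1, -1, -1], ![-1, 1, -1], ![-1, -1, 1]]

def PP (a b c d : ℝ) (i : Fin 4) : Fin 3 → ℝ := nrm a b c d • W i
def QQ (a b c d : ℝ) (i : Fin 4) : Fin 3 → ℝ := -((rot a b c d).mulVec (W i))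

def SS (a b c d : ℝ) : Set (Fin 3 → ℝ) := Set.range (PP a b c d) ∪ Set.range (QQ a b c d)

lemma PP_eq (a b c d : ℝ) : PP a b c d = ![
    ![nrm a b c d, nrm a b c d, nrm a b c d], ![nrm a b c d, -nrm a b c d, -nrm a b c d],
    ![-nrm a b c d, nrm a b c d, -nrm a b c d], ![-nrm a b c d, -nrm a b c d, nrm a b c d]] := by
  ext i j; fin_cases i <;> fin_cases j <;> simp [PP, W]

lemma QQ_eq (a b c d : ℝ) : QQ a b c d = ![
    ![-(a ^ 2 + b ^ 2 - c ^ 2 - d ^ 2 + 2 * (b * c - a * d) + 2 * (b * d + a * c)),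
      -(2 * (b * c + a * d) + (a ^ 2 - b ^ 2 + c ^ 2 - d ^ 2) + 2 * (c * d - a * b)),
      -(2 * (b * d - a * c) + 2 * (c * d + a * b) + (a ^ 2 - b ^ 2 - c ^ 2 + d ^ 2))],
    ![-(a ^ 2 + b ^ 2 - c ^ 2 - d ^ 2 - 2 * (b * c - a * d) - 2 * (b * d + a * c)),
      -(2 * (b * c + a * d) - (a ^ 2 - b ^ 2 + c ^ 2 - d ^ 2) - 2 * (c * d - a * b)),
      -(2 * (b * d - a * c) - 2 * (c * d + a * b) - (a ^ 2 - b ^ 2 - c ^ 2 + d ^ 2))],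
    ![-(-(a ^ 2 + b ^ 2 - c ^ 2 - d ^ 2) + 2 * (b * c - a * d) - 2 * (b * d + a * c)),
      -(-(2 * (b * c + a * d)) + (a ^ 2 - b ^ 2 + c ^ 2 - d ^ 2) - 2 * (c * d - a * b)),
      -(-(2 * (b * d - a * c)) + 2 * (c * d + a * b) - (a ^ 2 - b ^ 2 - c ^ 2 + d ^ 2))],
    ![-(-(a ^ 2 + b ^ 2 - c ^ 2 - d ^ 2) - 2 * (b * c - a * d) + 2 * (b * d + a * c)),
      -(-(2 * (b * c + a * d)) - (a ^ 2 - b ^ 2 + c ^ 2 - d ^ 2) + 2 * (c * d - a * b)),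
      -(-(2 * (b * d - a * c)) - 2 * (c * d + a * b) + (a ^ 2 - b ^ 2 - c ^ 2 + d ^ 2))]] := by
  ext i j
  fin_cases i <;> fin_cases j <;>
    simp [QQ, W, rot] <;> ring

lemma forall_SS {a b c d : ℝ} {p : (Fin 3 → ℝ) → Prop}
    (hP : ∀ i, p (PP a b c d i)) (hQ : ∀ i, p (QQ a b c d i)) : ∀ w ∈ SS a b c d, p w := by
  rintro w (⟨i, rfl⟩ | ⟨i, rfl⟩)
  · exact hP i
  · exact hQ i

lemma D4_zero1 (A B C : Fin 3 → ℝ) : D4 A B C A = 0 := by unfold D4; ring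
lemma D4_zero2 (A B C : Fin 3 → ℝ) : D4 A B C B = 0 := by unfold D4; ring
lemma D4_zero3 (A B C : Fin 3 → ℝ) : D4 A B C C = 0 := by unfold D4; ring

lemma vol_six {S A1 A2 A3 A4 A5 A6 : Set (Fin 3 → ℝ)}
    (h : S ⊆ A1 ∪ A2 ∪ A3 ∪ A4 ∪ A5 ∪ A6) :
    volume S ≤ volume A1 + volume A2 + volume A3 + volume A4 + volume A5 + volume A6 := by
  refine (measure_mono h).trans ((measure_union_le _ _).trans ?_)
  gcongr
  refine (measure_union_le _ _).trans ?_
  gcongr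
  refine (measure_union_le _ _).trans ?_
  gcongr
  refine (measure_union_le _ _).trans ?_
  gcongr
  exact measure_union_le _ _

lemma vol_pos_1 {e b c d : ℝ} (he : 0 < e) (hb : 0 ≤ b) (hc : 0 ≤ c) (hd : 0 ≤ d) :
    0 < D4 (PP (e + b + c + d) b c d 1) (QQ (e + b + c + d) b c d 1)
      (PP (e + b + c + d) b c d 2) (PP (e + b + c + d) b c d 3) := by
  simp only [D4, PP_eq, QQ_eq, nrm, Matrix.cons_val]
  ring_nf
  positivity

lemma vol_pos_2 {e b c d : ℝ} (he : 0 < e) (hb : 0 ≤ b) (hc : 0 ≤ c) (hd : 0 ≤ d) :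
    0 < D4 (PP (e + b + c + d) b c d 1) (QQ (e + b + c + d) b c d 1)
      (PP (e + b + c + d) b c d 3) (QQ (e + b + c + d) b c d 2) := by
  simp only [D4, PP_eq, QQ_eq, nrm, Matrix.cons_val]
  ring_nf
  positivity

lemma vol_pos_3 {e b c d : ℝ} (he : 0 < e) (hb : 0 ≤ b) (hc : 0 ≤ c) (hd : 0 ≤ d) :
    0 < D4 (PP (e + b + c + d) b c d 1) (QQ (e + b + c + d) b c d 1)
      (QQ (e + b + c + d) b c d 2) (QQ (e + b + c + d) b c d 3) := by
  simp only [D4, PP_eq, QQ_eq, nrm, Matrix.cons_val]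
  ring_nf
  positivity

lemma vol_pos_4 {e b c d : ℝ} (he : 0 < e) (hb : 0 ≤ b) (hc : 0 ≤ c) (hd : 0 ≤ d) :
    0 < D4 (PP (e + b + c + d) b c d 1) (QQ (e + b + c + d) b c d 1)
      (QQ (e + b + c + d) b c d 3) (PP (e + b + c + d) b c d 2) := by
  simp only [D4, PP_eq, QQ_eq, nrm, Matrix.cons_val]
  ring_nf
  positivity

lemma vol_pos_5 {e b c d : ℝ} (he : 0 < e) (hb : 0 ≤ b) (hc : 0 ≤ c) (hd : 0 ≤ d) :
    0 < D4 (QQ (e + b + c + d) b c d 0) (PP (e + b + c + d) b c d 1)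
      (PP (e + b + c + d) b c d 2) (PP (e + b + c + d) b c d 3) := by
  simp only [D4, PP_eq, QQ_eq, nrm, Matrix.cons_val]
  ring_nf
  positivity

lemma vol_pos_6 {e b c d : ℝ} (he : 0 < e) (hb : 0 ≤ b) (hc : 0 ≤ c) (hd : 0 ≤ d) :
    0 < D4 (PP (e + b + c + d) b c d 0) (QQ (e + b + c + d) b c d 1)
      (QQ (e + b + c + d) b c d 3) (QQ (e + b + c + d) b c d 2) := by
  simp only [D4, PP_eq, QQ_eq, nrm, Matrix.cons_val]
  ring_nf
  positivity

lemma facet_PPQ {a b c d : ℝ} (ha : b + c + d < a) (hb : 0 ≤ b)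
    (hc : 0 ≤ c) (hd : 0 ≤ d) :
    ∀ w ∈ SS a b c d, 0 ≤ D4 (QQ a b c d 1) (PP a b c d 3) (PP a b c d 2) w := by
  obtain ⟨e, he, rfl⟩ : ∃ e, 0 < e ∧ a = e + b + c + d := ⟨a - (b + c + d), by linarith, by ring⟩
  refine forall_SS ?_ ?_ <;> intro i <;> fin_cases i <;>
    simp only [Fin.mk_one, Fin.zero_eta, Fin.reduceFinMk] <;>
    first
    | with_reducible exact (D4_zero1 _ _ _).ge
    | with_reducible exact (D4_zero2 _ _ _).ge
    | with_reducible exact (D4_zero3 _ _ _).ge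
    | (simp only [D4, PP_eq, QQ_eq, nrm, Matrix.cons_val]
       ring_nf
       positivity)

lemma facet_QQP {a b c d : ℝ} (ha : b + c + d < a) (hb : 0 ≤ b)
    (hc : 0 ≤ c) (hd : 0 ≤ d) :
    ∀ w ∈ SS a b c d, 0 ≤ D4 (PP a b c d 1) (QQ a b c d 2) (QQ a b c d 3) w := by
  obtain ⟨e, he, rfl⟩ : ∃ e, 0 < e ∧ a = e + b + c + d := ⟨a - (b + c + d), by linarith, by ring⟩
  refine forall_SS ?_ ?_ <;> intro i <;> fin_cases i <;>
    simp only [Fin.mk_one, Fin.zero_eta, Fin.reduceFinMk] <;>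
    first
    | with_reducible exact (D4_zero1 _ _ _).ge
    | with_reducible exact (D4_zero2 _ _ _).ge
    | with_reducible exact (D4_zero3 _ _ _).ge
    | (simp only [D4, PP_eq, QQ_eq, nrm, Matrix.cons_val]
       ring_nf
       positivity)

lemma facet_capQ {a b c d : ℝ} (ha : b + c + d < a) (hb : 0 ≤ b)
    (hc : 0 ≤ c) (hd : 0 ≤ d) :
    ∀ w ∈ SS a b c d, 0 ≤ D4 (QQ a b c d 0) (PP a b c d 2) (PP a b c d 3) w := by
  obtain ⟨e, he, rfl⟩ : ∃ e, 0 < e ∧ a = e + b + c + d := ⟨a - (b + c + d), by linarith, by ring⟩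
  refine forall_SS ?_ ?_ <;> intro i <;> fin_cases i <;>
    simp only [Fin.mk_one, Fin.zero_eta, Fin.reduceFinMk] <;>
    first
    | with_reducible exact (D4_zero1 _ _ _).ge
    | with_reducible exact (D4_zero2 _ _ _).ge
    | with_reducible exact (D4_zero3 _ _ _).ge
    | (simp only [D4, PP_eq, QQ_eq, nrm, Matrix.cons_val]
       ring_nf
       positivity)

lemma facet_capP {a b c d : ℝ} (ha : b + c + d < a) (hb : 0 ≤ b)
    (hc : 0 ≤ c) (hd : 0 ≤ d) :
    ∀ w ∈ SS a b c d, 0 ≤ D4 (PP a b c d 0) (QQ a b c d 3) (QQ a b c d 2) w := by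
  obtain ⟨e, he, rfl⟩ : ∃ e, 0 < e ∧ a = e + b + c + d := ⟨a - (b + c + d), by linarith, by ring⟩
  refine forall_SS ?_ ?_ <;> intro i <;> fin_cases i <;>
    simp only [Fin.mk_one, Fin.zero_eta, Fin.reduceFinMk] <;>
    first
    | with_reducible exact (D4_zero1 _ _ _).ge
    | with_reducible exact (D4_zero2 _ _ _).ge
    | with_reducible exact (D4_zero3 _ _ _).ge
    | (simp only [D4, PP_eq, QQ_eq, nrm, Matrix.cons_val]
       ring_nf
       positivity)

/-- cyclic shift of coordinates -/
def sh (x : Fin 3 → ℝ) : Fin 3 → ℝ := ![x 2, x 0, x 1]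

/-- cyclic permutation of the vertices -/
def cyc : Fin 4 → Fin 4 := ![0, 2, 3, 1]

lemma sh_PP (a b c d : ℝ) (i : Fin 4) : sh (PP a c d b i) = PP a b c d (cyc i) := by
  rw [PP_eq, PP_eq]
  have : nrm a c d b = nrm a b c d := by unfold nrm; ring
  rw [this]
  ext j
  fin_cases i <;> fin_cases j <;> simp [sh, cyc]

lemma sh_QQ (a b c d : ℝ) (i : Fin 4) : sh (QQ a c d b i) = QQ a b c d (cyc i) := by
  rw [QQ_eq, QQ_eq]
  ext j
  fin_cases i <;> fin_cases j <;> simp [sh, cyc] <;> ring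

lemma D4_rot (A B C X : Fin 3 → ℝ) : D4 A B C X = D4 B C A X := by unfold D4; ring

lemma sh_facet {a b c d : ℝ} {A B C : Fin 3 → ℝ} (h : ∀ w ∈ SS a c d b, 0 ≤ D4 A B C w) :
    ∀ w ∈ SS a b c d, 0 ≤ D4 (sh A) (sh B) (sh C) w := by
  have hcyc : ∀ i, ∃ j, cyc j = i := by decide
  have hs : ∀ X, D4 (sh A) (sh B) (sh C) (sh X) = D4 A B C X := by
    intro X; simp only [D4, sh, Matrix.cons_val]; ring
  refine forall_SS ?_ ?_
  · intro i
    obtain ⟨j, rfl⟩ := hcyc i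
    rw [← sh_PP, hs]
    exact h _ (Or.inl ⟨j, rfl⟩)
  · intro i
    obtain ⟨j, rfl⟩ := hcyc i
    rw [← sh_QQ, hs]
    exact h _ (Or.inr ⟨j, rfl⟩)

set_option maxHeartbeats 1000000 in
lemma core_strict (e b c d : ℝ) (he : 0 < e) (hb : 0 ≤ b) (hc : 0 ≤ c) (hd : 0 ≤ d) :
    volume (convexHull ℝ (SS (e + b + c + d) b c d)) ≤
      ENNReal.ofReal (8 * nrm (e + b + c + d) b c d ^ 3) := by
  have h := hull_subset_tets (PP (e + b + c + d) b c d 0) (PP (e + b + c + d) b c d 1)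
    (PP (e + b + c + d) b c d 2) (PP (e + b + c + d) b c d 3)
    (QQ (e + b + c + d) b c d 0) (QQ (e + b + c + d) b c d 1)
    (QQ (e + b + c + d) b c d 2) (QQ (e + b + c + d) b c d 3) (SS (e + b + c + d) b c d)
  have t1 := vol_pos_1 he hb hc hd
  have t2 := vol_pos_2 he hb hc hd
  have t3 := vol_pos_3 he hb hc hd
  have t4 := vol_pos_4 he hb hc hd
  have t5 := vol_pos_5 he hb hc hd
  have t6 := vol_pos_6 he hb hc hd
  specialize h t1 t2 t3 t4 t5 t6
  have cyc0 : cyc 0 = 0 := rfl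
  have cyc1 : cyc 1 = 2 := rfl
  have cyc2 : cyc 2 = 3 := rfl
  have cyc3 : cyc 3 = 1 := rfl
  have h0 : b + c + d < e + b + c + d := by linarith
  have h1 : c + d + b < e + b + c + d := by linarith
  have h2 : d + b + c < e + b + c + d := by linarith
  have l1 := facet_PPQ h0 hb hc hd
  have l3 := sh_facet (facet_PPQ h1 hc hd hb)
  have l6 := sh_facet (sh_facet (facet_PPQ h2 hd hb hc))
  have l4 := facet_QQP h0 hb hc hd
  have l5 := sh_facet (facet_QQP h1 hc hd hb)
  have l2 := sh_facet (sh_facet (facet_QQP h2 hd hb hc))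
  have c1 := facet_capQ h0 hb hc hd
  have c2 := sh_facet (facet_capQ h1 hc hd hb)
  have c3 := sh_facet (sh_facet (facet_capQ h2 hd hb hc))
  have d1 := facet_capP h0 hb hc hd
  have d3 := sh_facet (facet_capP h1 hc hd hb)
  have d2 := sh_facet (sh_facet (facet_capP h2 hd hb hc))
  simp only [sh_PP, sh_QQ, cyc0, cyc1, cyc2, cyc3] at l3 l6 l5 l2 c2 c3 d2 d3
  refine (vol_six (h l1 (fun w hw => (l2 w hw).trans_eq (D4_rot _ _ _ _))
    (fun w hw => (l3 w hw).trans_eq (D4_rot _ _ _ _)) l4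
    (fun w hw => (l5 w hw).trans_eq ((D4_rot _ _ _ _).trans (D4_rot _ _ _ _)))
    (fun w hw => (l6 w hw).trans_eq ((D4_rot _ _ _ _).trans (D4_rot _ _ _ _)))
    c1 c2 c3 d1 d2 d3)).trans ?_
  · refine (add_le_add (add_le_add (add_le_add (add_le_add (add_le_add (vol_tet _ _ _ _ t1.le)
      (vol_tet _ _ _ _ t2.le)) (vol_tet _ _ _ _ t3.le)) (vol_tet _ _ _ _ t4.le))
      (vol_tet _ _ _ _ t5.le)) (vol_tet _ _ _ _ t6.le)).trans ?_
    rw [← ENNReal.ofReal_add (by positivity) (by positivity),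
      ← ENNReal.ofReal_add (by positivity) (by positivity),
      ← ENNReal.ofReal_add (by positivity) (by positivity),
      ← ENNReal.ofReal_add (by positivity) (by positivity),
      ← ENNReal.ofReal_add (by positivity) (by positivity)]
    apply ENNReal.ofReal_le_ofReal
    have hn : 0 ≤ nrm (e + b + c + d) b c d ^ 2 := by positivity
    have key : 0 ≤ nrm (e + b + c + d) b c d ^ 2 *
      (2 * (b ^ 2 + c ^ 2 + d ^ 2) - (b * c + b * d + c * d)) :=
      mul_nonneg hn (by nlinarith [sq_nonneg (b - c), sq_nonneg (c - d), sq_nonneg (b - d)])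
    refine le_of_sub_nonneg (le_of_le_of_eq (mul_nonneg (show (0:ℝ) ≤ 16 / 3 by norm_num) key) ?_)
    generalize e + b + c + d = a
    simp only [D4, PP_eq, QQ_eq, nrm, Matrix.cons_val]
    ring


/-- The volume bound for the configuration given by a quaternion. -/
def Good (a b c d : ℝ) : Prop :=
  volume (convexHull ℝ (SS a b c d)) ≤ ENNReal.ofReal (8 * nrm a b c d ^ 3)

lemma continuous_PP (a b c d : ℝ) (i : Fin 4) (j : Fin 3) :
    Continuous fun t : ℝ => PP (a + t) b c d i j := by
  simp only [PP, nrm, Pi.smul_apply, smul_eq_mul]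
  fun_prop

lemma continuous_QQ (a b c d : ℝ) (i : Fin 4) (j : Fin 3) :
    Continuous fun t : ℝ => QQ (a + t) b c d i j := by
  rw [show (fun t : ℝ => QQ (a + t) b c d i j) = fun t : ℝ =>
    (![_, _, _, _] : Fin 4 → Fin 3 → ℝ) i j from funext fun t => by rw [QQ_eq]]
  fin_cases i <;> fin_cases j <;> simp <;> fun_prop

lemma ball_mem (a b c d : ℝ) (hn : 0 < nrm a b c d) (y : Fin 3 → ℝ)
    (hy : ∀ j, |y j| ≤ nrm a b c d / 3) : y ∈ convexHull ℝ (SS a b c d) := by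
  have hy' := fun j => abs_le.1 (hy j)
  have h0 := hy' 0
  have h1 := hy' 1
  have h2 := hy' 2
  generalize hnn : nrm a b c d = n at *
  have key : y = ∑ i, (![(1 + (y 0 + y 1 + y 2) / n) / 4, (1 + (y 0 - y 1 - y 2) / n) / 4,
      (1 + (-y 0 + y 1 - y 2) / n) / 4, (1 + (-y 0 - y 1 + y 2) / n) / 4] : Fin 4 → ℝ) i •
      PP a b c d i := by
    rw [PP_eq, hnn]
    ext j
    fin_cases j <;> simp [Fin.sum_univ_four] <;> field_simp <;> ring
  rw [key]
  refine (convex_convexHull ℝ _).sum_mem ?_ ?_ ?_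
  · intro i _
    have hh : ∀ z, -n ≤ z → 0 ≤ (1 + z / n) / 4 := by
      intro z hz
      have : -1 ≤ z / n := by rw [le_div_iff₀ hn]; linarith
      linarith
    fin_cases i <;> simp only [Matrix.cons_val, Fin.mk_one, Fin.zero_eta, Fin.reduceFinMk] <;>
      apply hh <;> linarith
  · simp [Fin.sum_univ_four]; field_simp; ring
  · intro i _
    exact subset_convexHull ℝ _ (Or.inl ⟨i, rfl⟩)

lemma core {a b c d : ℝ} (ha : 0 < a) (hb : 0 ≤ b) (hc : 0 ≤ c) (hd : 0 ≤ d)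
    (h : b + c + d ≤ a) : Good a b c d := by
  have hstrict : ∀ t, 0 < t → Good (a + t) b c d := by
    intro t ht
    have := core_strict (a + t - (b + c + d)) b c d (by linarith) hb hc hd
    have e : a + t - (b + c + d) + b + c + d = a + t := by ring
    rw [e] at this
    exact this
  have hn0 : 0 < nrm a b c d := by unfold nrm; positivity
  have hs : ∀ s : ℝ, 0 < s → s < 1 → ENNReal.ofReal (|s ^ 3|) * volume (convexHull ℝ (SS a b c d))
      ≤ ENNReal.ofReal (8 * nrm a b c d ^ 3) := by
    intro s hs0 hs1
    have hev : ∀ f : ℝ → ℝ, Continuous f →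
        ∀ᶠ t in nhdsWithin (0:ℝ) (Set.Ioi 0), |s * (f 0 - f t)| ≤ (1 - s) * (nrm a b c d / 3) := by
      intro f hf
      have : Filter.Tendsto (fun t => |s * (f 0 - f t)|) (nhdsWithin (0:ℝ) (Set.Ioi 0)) (nhds 0) := by
        have hc : Continuous fun t => |s * (f 0 - f t)| := by fun_prop
        have := hc.tendsto 0
        simp only [sub_self, mul_zero, abs_zero] at this
        exact this.mono_left nhdsWithin_le_nhds
      refine (this.eventually_lt_const (u := (1 - s) * (nrm a b c d / 3)) ?_).mono fun t ht => ht.le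
      have : 0 < 1 - s := by linarith
      positivity
    have hP : ∀ᶠ t in nhdsWithin (0:ℝ) (Set.Ioi 0), ∀ i : Fin 4, ∀ j : Fin 3,
        |s * (PP (a + 0) b c d i j - PP (a + t) b c d i j)| ≤ (1 - s) * (nrm a b c d / 3) :=
      Filter.eventually_all.2 fun i => Filter.eventually_all.2 fun j =>
        hev _ (continuous_PP a b c d i j)
    have hQ : ∀ᶠ t in nhdsWithin (0:ℝ) (Set.Ioi 0), ∀ i : Fin 4, ∀ j : Fin 3,
        |s * (QQ (a + 0) b c d i j - QQ (a + t) b c d i j)| ≤ (1 - s) * (nrm a b c d / 3) :=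
      Filter.eventually_all.2 fun i => Filter.eventually_all.2 fun j =>
        hev _ (continuous_QQ a b c d i j)
    have hle : ∀ᶠ t in nhdsWithin (0:ℝ) (Set.Ioi 0),
        ENNReal.ofReal (|s ^ 3|) * volume (convexHull ℝ (SS a b c d))
          ≤ ENNReal.ofReal (8 * nrm (a + t) b c d ^ 3) := by
      filter_upwards [hP, hQ, self_mem_nhdsWithin] with t h1 h2 ht
      have ht : 0 < t := ht
      simp only [add_zero] at h1 h2
      refine le_trans ?_ (hstrict t ht)
      have hn : nrm a b c d ≤ nrm (a + t) b c d := by unfold nrm; nlinarith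
      have hnt : 0 < nrm (a + t) b c d := hn0.trans_le hn
      have hfr : Module.finrank ℝ (Fin 3 → ℝ) = 3 := by simp
      have hsm := Measure.addHaar_smul (volume : Measure (Fin 3 → ℝ)) s (convexHull ℝ (SS a b c d))
      rw [hfr] at hsm
      rw [← hsm, ← convexHull_smul]
      apply measure_mono
      apply convexHull_min _ (convex_convexHull ℝ _)
      have h1s : 0 < 1 - s := by linarith
      have gen : ∀ w w' : Fin 3 → ℝ, w' ∈ SS (a + t) b c d →
          (∀ j, |s * (w j - w' j)| ≤ (1 - s) * (nrm a b c d / 3)) →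
          s • w ∈ convexHull ℝ (SS (a + t) b c d) := by
        intro w w' hw' hd
        have hy := ball_mem (a + t) b c d hnt (fun j => s * (w j - w' j) / (1 - s)) (by
          intro j
          rw [abs_div, abs_of_pos h1s, div_le_iff₀ h1s]
          refine (hd j).trans ?_
          rw [mul_comm]; gcongr)
        have := (convex_convexHull ℝ _) (subset_convexHull ℝ _ hw') hy hs0.le h1s.le (by ring)
        convert this using 1
        ext j
        simp
        field_simp
        ring
      rintro _ ⟨w, (⟨i, rfl⟩ | ⟨i, rfl⟩), rfl⟩
      · exact gen _ _ (Or.inl ⟨i, rfl⟩) (h1 i)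
      · exact gen _ _ (Or.inr ⟨i, rfl⟩) (h2 i)
    have hcont : Filter.Tendsto (fun t => ENNReal.ofReal (8 * nrm (a + t) b c d ^ 3))
        (nhdsWithin (0:ℝ) (Set.Ioi 0)) (nhds (ENNReal.ofReal (8 * nrm a b c d ^ 3))) := by
      have hc : Continuous fun t => ENNReal.ofReal (8 * nrm (a + t) b c d ^ 3) := by
        unfold nrm; exact ENNReal.continuous_ofReal.comp (by fun_prop)
      have := hc.tendsto 0
      simp only [add_zero] at this
      exact this.mono_left nhdsWithin_le_nhds
    exact ge_of_tendsto hcont hle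
  have hlim : Filter.Tendsto (fun s : ℝ => ENNReal.ofReal (|s ^ 3|) *
      volume (convexHull ℝ (SS a b c d))) (nhdsWithin (1:ℝ) (Set.Iio 1))
      (nhds (1 * volume (convexHull ℝ (SS a b c d)))) := by
    refine ENNReal.Tendsto.mul_const ?_ (Or.inl one_ne_zero)
    have hc : Continuous fun s : ℝ => ENNReal.ofReal (|s ^ 3|) :=
      ENNReal.continuous_ofReal.comp (by fun_prop)
    have := hc.tendsto 1
    simp only [one_pow, abs_one, ENNReal.ofReal_one] at this
    exact this.mono_left nhdsWithin_le_nhds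
  rw [one_mul] at hlim
  refine le_of_tendsto hlim ?_
  filter_upwards [Ioo_mem_nhdsLT (show (0:ℝ) < 1 by norm_num)] with s hs'
  exact hs s hs'.1 hs'.2

/-- Volume comparison under a volume preserving linear map. -/
lemma vol_hull_le {S T : Set (Fin 3 → ℝ)} (A : Matrix (Fin 3) (Fin 3) ℝ) (hA : |A.det| = 1)
    (h : T ⊆ A.mulVec '' S) : volume (convexHull ℝ T) ≤ volume (convexHull ℝ S) := by
  have h1 : convexHull ℝ T ⊆ (Matrix.toLin' A) '' convexHull ℝ S := by
    rw [LinearMap.image_convexHull]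
    exact convexHull_mono h
  refine (measure_mono h1).trans ?_
  rw [Measure.addHaar_image_linearMap, LinearMap.det_toLin', hA]
  simp

lemma Good.of_map {a b c d a' b' c' d' : ℝ} (h : Good a b c d)
    (hn : nrm a' b' c' d' = nrm a b c d) (A : Matrix (Fin 3) (Fin 3) ℝ) (hA : |A.det| = 1)
    (hP : ∀ i, PP a' b' c' d' i ∈ A.mulVec '' SS a b c d)
    (hQ : ∀ i, QQ a' b' c' d' i ∈ A.mulVec '' SS a b c d) : Good a' b' c' d' := by
  unfold Good
  rw [hn]
  refine (vol_hull_le A hA ?_).trans h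
  exact forall_SS hP hQ

lemma Good.of_perm {a b c d a' b' c' d' : ℝ} (h : Good a b c d)
    (hn : nrm a' b' c' d' = nrm a b c d) (σ : Fin 4 → Fin 4)
    (hQ : ∀ i, QQ a' b' c' d' i = QQ a b c d (σ i)) : Good a' b' c' d' := by
  refine h.of_map hn 1 (by simp) ?_ ?_
  · intro i
    exact ⟨PP a b c d i, Or.inl ⟨i, rfl⟩, by simp [PP, hn]⟩
  · intro i
    exact ⟨QQ a b c d (σ i), Or.inr ⟨_, rfl⟩, by simp [hQ]⟩

lemma Good.neg {a b c d : ℝ} (h : Good a b c d) : Good (-a) (-b) (-c) (-d) := by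
  refine h.of_perm (by unfold nrm; ring) id ?_
  intro i
  rw [QQ_eq, QQ_eq]; ext j
  fin_cases i <;> fin_cases j <;> simp

lemma Good.mulI {a b c d : ℝ} (h : Good (-b) a d (-c)) : Good a b c d := by
  refine h.of_perm (by unfold nrm; ring) ![1, 0, 3, 2] ?_
  intro i
  rw [QQ_eq, QQ_eq]; ext j
  fin_cases i <;> fin_cases j <;> simp <;> ring

lemma Good.mulJ {a b c d : ℝ} (h : Good (-c) (-d) a b) : Good a b c d := by
  refine h.of_perm (by unfold nrm; ring) ![2, 3, 0, 1] ?_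
  intro i
  rw [QQ_eq, QQ_eq]; ext j
  fin_cases i <;> fin_cases j <;> simp <;> ring

lemma Good.mulK {a b c d : ℝ} (h : Good (-d) c (-b) a) : Good a b c d := by
  refine h.of_perm (by unfold nrm; ring) ![3, 2, 1, 0] ?_
  intro i
  rw [QQ_eq, QQ_eq]; ext j
  fin_cases i <;> fin_cases j <;> simp <;> ring

lemma Good.mulW {a b c d : ℝ} (h : Good ((a + b + c + d) / 2) ((b - a - c + d) / 2)
    ((c - a - d + b) / 2) ((d - a - b + c) / 2)) : Good a b c d := by
  refine h.of_perm (by unfold nrm; ring) ![0, 2, 3, 1] ?_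
  intro i
  rw [QQ_eq, QQ_eq]; ext j
  fin_cases i <;> fin_cases j <;> simp <;> ring

lemma Good.conjI {a b c d : ℝ} (h : Good a b c d) : Good a b (-c) (-d) := by
  refine h.of_map (by unfold nrm; ring) (Matrix.diagonal ![1, -1, -1])
    (by simp [Matrix.det_diagonal, Fin.prod_univ_three]) ?_ ?_
  · intro i
    refine ⟨PP a b c d (![1, 0, 3, 2] i), Or.inl ⟨_, rfl⟩, ?_⟩
    rw [PP_eq, PP_eq]; ext j
    fin_cases i <;> fin_cases j <;> simp [Matrix.mulVec_diagonal, nrm]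
  · intro i
    refine ⟨QQ a b c d (![1, 0, 3, 2] i), Or.inr ⟨_, rfl⟩, ?_⟩
    rw [QQ_eq, QQ_eq]; ext j
    fin_cases i <;> fin_cases j <;> simp [Matrix.mulVec_diagonal] <;> ring

lemma Good.conjJ {a b c d : ℝ} (h : Good a b c d) : Good a (-b) c (-d) := by
  refine h.of_map (by unfold nrm; ring) (Matrix.diagonal ![-1, 1, -1])
    (by simp [Matrix.det_diagonal, Fin.prod_univ_three]) ?_ ?_
  · intro i
    refine ⟨PP a b c d (![2, 3, 0, 1] i), Or.inl ⟨_, rfl⟩, ?_⟩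
    rw [PP_eq, PP_eq]; ext j
    fin_cases i <;> fin_cases j <;> simp [Matrix.mulVec_diagonal, nrm]
  · intro i
    refine ⟨QQ a b c d (![2, 3, 0, 1] i), Or.inr ⟨_, rfl⟩, ?_⟩
    rw [QQ_eq, QQ_eq]; ext j
    fin_cases i <;> fin_cases j <;> simp [Matrix.mulVec_diagonal] <;> ring

lemma rot_transpose_mul (a b c d : ℝ) :
    (rot a b c d).transpose * rot a b c d = (nrm a b c d ^ 2) • 1 := by
  ext i j
  fin_cases i <;> fin_cases j <;> simp [rot, nrm, Matrix.mul_apply, Fin.sum_univ_three] <;> ring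

lemma rot_inv (a b c d : ℝ) : rot a (-b) (-c) (-d) = (rot a b c d).transpose := by
  ext i j
  fin_cases i <;> fin_cases j <;> simp [rot] <;> ring

lemma rot_det (a b c d : ℝ) : (rot a b c d).det = nrm a b c d ^ 3 := by
  rw [Matrix.det_fin_three]; simp [rot, nrm]; ring

lemma Good.inv {a b c d : ℝ} (h : Good a b c d) (hn : 0 < nrm a b c d) :
    Good a (-b) (-c) (-d) := by
  have hn' : nrm a (-b) (-c) (-d) = nrm a b c d := by unfold nrm; ring
  refine h.of_map hn' ((-(nrm a b c d)⁻¹) • (rot a b c d).transpose) ?_ ?_ ?_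
  · rw [Matrix.det_smul, Matrix.det_transpose, rot_det]
    simp only [Fintype.card_fin]
    rw [← mul_pow, neg_mul, inv_mul_cancel₀ hn.ne']
    norm_num
  · intro i
    refine ⟨QQ a b c d i, Or.inr ⟨_, rfl⟩, ?_⟩
    simp only [PP, QQ, hn']
    rw [Matrix.mulVec_neg, Matrix.smul_mulVec, Matrix.mulVec_mulVec, rot_transpose_mul]
    ext j
    simp [Matrix.smul_mulVec]
    field_simp
  · intro i
    refine ⟨PP a b c d i, Or.inl ⟨_, rfl⟩, ?_⟩
    simp only [PP, QQ, rot_inv]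
    rw [Matrix.mulVec_smul, Matrix.smul_mulVec]
    ext j
    simp
    field_simp

lemma good_abs3 {a b c d : ℝ} (hn : 0 < nrm a b c d) (h : Good a |b| |c| |d|) :
    Good a b c d := by
  have hn2 : nrm a |b| |c| |d| = nrm a b c d := by simp [nrm]
  rw [← hn2] at hn
  have hi := h.inv hn
  rcases abs_cases b with ⟨e1, _⟩ | ⟨e1, _⟩ <;> rcases abs_cases c with ⟨e2, _⟩ | ⟨e2, _⟩ <;>
    rcases abs_cases d with ⟨e3, _⟩ | ⟨e3, _⟩ <;> rw [e1, e2, e3] at h hi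
  · exact h
  · simpa using hi.conjI.conjJ
  · simpa using hi.conjJ
  · simpa using h.conjI
  · simpa using hi.conjI
  · simpa using h.conjJ
  · simpa using h.conjI.conjJ
  · simpa using hi

lemma good_abs {a b c d : ℝ} (hn : 0 < nrm a b c d) (h : Good |a| |b| |c| |d|) :
    Good a b c d := by
  rcases abs_cases a with ⟨e1, _⟩ | ⟨e1, _⟩ <;> rw [e1] at h
  · exact good_abs3 hn h
  · have h2 : Good (-a) (-b) (-c) (-d) := by
      apply good_abs3 (by unfold nrm at *; linarith)
      simpa using h
    simpa using h2.neg

lemma good_max {a b c d : ℝ} (ha : 0 < a) (hb : 0 ≤ b) (hc : 0 ≤ c) (hd : 0 ≤ d)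
    (hba : b ≤ a) (hca : c ≤ a) (hda : d ≤ a) : Good a b c d := by
  rcases le_or_gt (b + c + d) a with h | h
  · exact core ha hb hc hd h
  · apply Good.mulW
    apply good_abs3 (by unfold nrm; positivity)
    apply core (by positivity) (abs_nonneg _) (abs_nonneg _) (abs_nonneg _)
    rcases abs_cases ((b - a - c + d) / 2) with ⟨e1, _⟩ | ⟨e1, _⟩ <;>
    rcases abs_cases ((c - a - d + b) / 2) with ⟨e2, _⟩ | ⟨e2, _⟩ <;>
    rcases abs_cases ((d - a - b + c) / 2) with ⟨e3, _⟩ | ⟨e3, _⟩ <;>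
    rw [e1, e2, e3] <;> linarith

theorem good_all {a b c d : ℝ} (hn : 0 < nrm a b c d) : Good a b c d := by
  apply good_abs hn
  have hn2 : 0 < nrm |a| |b| |c| |d| := by simpa [nrm] using hn
  have ha := abs_nonneg a
  have hb := abs_nonneg b
  have hc := abs_nonneg c
  have hd := abs_nonneg d
  generalize |a| = a at *
  generalize |b| = b at *
  generalize |c| = c at *
  generalize |d| = d at *
  have hpos : 0 < a ∨ 0 < b ∨ 0 < c ∨ 0 < d := by
    by_contra! hcon
    obtain ⟨h1, h2, h3, h4⟩ := hcon
    have e1 : a = 0 := le_antisymm h1 ha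
    have e2 : b = 0 := le_antisymm h2 hb
    have e3 : c = 0 := le_antisymm h3 hc
    have e4 : d = 0 := le_antisymm h4 hd
    subst e1 e2 e3 e4
    simp [nrm] at hn2
  by_cases hA : b ≤ a ∧ c ≤ a ∧ d ≤ a
  · refine good_max ?_ hb hc hd hA.1 hA.2.1 hA.2.2
    rcases hpos with h | h | h | h <;> linarith
  by_cases hB : a ≤ b ∧ c ≤ b ∧ d ≤ b
  · apply Good.mulI
    apply good_abs (by unfold nrm at *; linarith)
    simp only [abs_neg, abs_of_nonneg ha, abs_of_nonneg hb, abs_of_nonneg hc, abs_of_nonneg hd]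
    refine good_max ?_ ha hd hc hB.1 hB.2.2 hB.2.1
    rcases hpos with h | h | h | h <;> linarith
  by_cases hC : a ≤ c ∧ b ≤ c ∧ d ≤ c
  · apply Good.mulJ
    apply good_abs (by unfold nrm at *; linarith)
    simp only [abs_neg, abs_of_nonneg ha, abs_of_nonneg hb, abs_of_nonneg hc, abs_of_nonneg hd]
    refine good_max ?_ hd ha hb hC.2.2 hC.1 hC.2.1
    rcases hpos with h | h | h | h <;> linarith
  have hD : a ≤ d ∧ b ≤ d ∧ c ≤ d := by
    grind
  apply Good.mulK
  apply good_abs (by unfold nrm at *; linarith)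
  simp only [abs_neg, abs_of_nonneg ha, abs_of_nonneg hb, abs_of_nonneg hc, abs_of_nonneg hd]
  refine good_max ?_ hc hb ha hD.2.2 hD.2.1 hD.1
  rcases hpos with h | h | h | h <;> linarith


/-- hull volume bound for the pair (standard tetrahedron, its image under `N`) -/
def Bd (N : Matrix (Fin 3) (Fin 3) ℝ) : Prop :=
  volume (convexHull ℝ (Set.range W ∪ Set.range fun i => N.mulVec (W i))) ≤ ENNReal.ofReal 8

lemma Bd.of_perm {N : Matrix (Fin 3) (Fin 3) ℝ} (D : Matrix (Fin 3) (Fin 3) ℝ) (h : Bd (N * D))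
    (hD : D * D = 1) (σ : Fin 4 → Fin 4) (hσ : ∀ i, D.mulVec (W i) = W (σ i)) : Bd N := by
  refine le_trans (measure_mono (convexHull_mono ?_)) h
  apply Set.union_subset_union_right
  rintro _ ⟨i, rfl⟩
  refine ⟨σ i, ?_⟩
  simp only
  rw [← hσ, Matrix.mulVec_mulVec, mul_assoc, hD, mul_one]

lemma quat {M : Matrix (Fin 3) (Fin 3) ℝ} (h1 : M.transpose * M = 1) (hd : M.det = 1)
    (ht : 0 < 1 + M.trace) : ∃ a b c d, 0 < nrm a b c d ∧ rot a b c d = nrm a b c d • M := by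
  have h2 : M * M.transpose = 1 := mul_eq_one_comm.1 h1
  have h3 : M.adjugate = M.transpose := by
    calc M.adjugate = M.transpose * M * M.adjugate := by rw [h1, one_mul]
      _ = M.transpose := by rw [mul_assoc, Matrix.mul_adjugate, hd, one_smul, mul_one]
  rw [Matrix.adjugate_fin_three] at h3
  rw [Matrix.trace_fin_three] at ht
  have e (i j) := congrFun (congrFun h1 i) j
  have f (i j) := congrFun (congrFun h2 i) j
  have g (i j) := congrFun (congrFun h3 i) j
  simp only [Matrix.mul_apply, Fin.sum_univ_three, Matrix.transpose_apply] at e f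
  simp only [Matrix.transpose_apply] at g
  have e00 := e 0 0
  have e11 := e 1 1
  have e22 := e 2 2
  have e01 := e 0 1
  have e02 := e 0 2
  have e12 := e 1 2
  have f00 := f 0 0
  have f11 := f 1 1
  have f22 := f 2 2
  have f01 := f 0 1
  have f02 := f 0 2
  have f12 := f 1 2
  have g00 := g 0 0
  have g01 := g 0 1
  have g02 := g 0 2
  have g10 := g 1 0
  have g11 := g 1 1
  have g12 := g 1 2
  have g20 := g 2 0
  have g21 := g 2 1
  have g22 := g 2 2
  clear e f g h1 h2 h3 hd
  simp at e00 e11 e22 e01 e02 e12 f00 f11 f22 f01 f02 f12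
  simp at g00 g01 g02 g10 g11 g12 g20 g21 g22
  have hn : nrm (1 + (M 0 0 + M 1 1 + M 2 2)) (M 2 1 - M 1 2) (M 0 2 - M 2 0) (M 1 0 - M 0 1)
      = 4 * (1 + (M 0 0 + M 1 1 + M 2 2)) := by
    unfold nrm
    linarith
  refine ⟨1 + (M 0 0 + M 1 1 + M 2 2), M 2 1 - M 1 2, M 0 2 - M 2 0, M 1 0 - M 0 1, ?_, ?_⟩
  · rw [hn]; linarith
  · rw [hn]
    ext i j
    fin_cases i <;> fin_cases j <;> simp [rot] <;> linarith

open scoped Pointwise in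
lemma Bd.of_rot {M : Matrix (Fin 3) (Fin 3) ℝ} (h1 : M.transpose * M = 1) (hd : M.det = 1)
    (ht : 0 < 1 + M.trace) : Bd (-M) := by
  obtain ⟨a, b, c, d, hn, hr⟩ := quat h1 hd ht
  have hg : volume (convexHull ℝ (SS a b c d)) ≤ ENNReal.ofReal (8 * nrm a b c d ^ 3) :=
    good_all hn
  have hS : SS a b c d =
      nrm a b c d • (Set.range W ∪ Set.range fun i => (-M).mulVec (W i)) := by
    rw [Set.smul_set_union, Set.smul_set_range, Set.smul_set_range]
    unfold SS
    congr 2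
    funext i
    simp [QQ, hr, Matrix.neg_mulVec, Matrix.smul_mulVec]
  have hfr : Module.finrank ℝ (Fin 3 → ℝ) = 3 := by simp
  rw [hS, convexHull_smul, Measure.addHaar_smul, hfr, abs_of_pos (pow_pos hn 3), mul_comm 8,
    ENNReal.ofReal_mul (pow_pos hn 3).le] at hg
  unfold Bd
  refine (ENNReal.mul_le_mul_iff_right ?_ ENNReal.ofReal_ne_top).1 hg
  simpa using pow_pos hn 3

lemma Bd.of_neg {N : Matrix (Fin 3) (Fin 3) ℝ} (h1 : N.transpose * N = 1) (hd : N.det = -1) :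
    Bd N := by
  have gen : ∀ v : Fin 3 → ℝ, (∀ i, v i * v i = 1) → v 0 * v 1 * v 2 = 1 →
      0 < 1 - (N 0 0 * v 0 + N 1 1 * v 1 + N 2 2 * v 2) → Bd (N * Matrix.diagonal v) := by
    intro v hv hv' ht
    have hvv : Matrix.diagonal v * Matrix.diagonal v = 1 := by
      rw [Matrix.diagonal_mul_diagonal]
      simp [hv]
    have := Bd.of_rot (M := -(N * Matrix.diagonal v)) ?_ ?_ ?_
    · simpa using this
    · rw [Matrix.transpose_neg, neg_mul_neg, Matrix.transpose_mul, Matrix.diagonal_transpose,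
        mul_assoc, ← mul_assoc N.transpose, h1, one_mul, hvv]
    · rw [Matrix.det_neg, Matrix.det_mul, hd, Matrix.det_diagonal, Fin.prod_univ_three, hv']
      simp; norm_num
    · rw [Matrix.trace_neg, Matrix.trace_fin_three]
      simp only [Matrix.mul_diagonal]
      linarith
  by_cases t0 : 0 < 1 - (N 0 0 + N 1 1 + N 2 2)
  · have := gen 1 (by simp) (by simp) (by simpa using t0)
    simpa using this
  by_cases t1 : 0 < 1 - (N 0 0 - N 1 1 - N 2 2)
  · refine Bd.of_perm _ (gen ![1, -1, -1] ?_ (by simp) (by simpa [sub_eq_add_neg] using t1)) ?_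
      ![1, 0, 3, 2] ?_
    · intro i; fin_cases i <;> simp
    · rw [Matrix.diagonal_mul_diagonal]
      ext i j; fin_cases i <;> fin_cases j <;> simp
    · intro i; ext j; fin_cases i <;> fin_cases j <;> simp [W, Matrix.mulVec_diagonal]
  by_cases t2 : 0 < 1 - (-N 0 0 + N 1 1 - N 2 2)
  · refine Bd.of_perm _ (gen ![-1, 1, -1] ?_ (by simp) (by simpa [sub_eq_add_neg] using t2)) ?_
      ![2, 3, 0, 1] ?_
    · intro i; fin_cases i <;> simp
    · rw [Matrix.diagonal_mul_diagonal]
      ext i j; fin_cases i <;> fin_cases j <;> simp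
    · intro i; ext j; fin_cases i <;> fin_cases j <;> simp [W, Matrix.mulVec_diagonal]
  · refine Bd.of_perm _ (gen ![-1, -1, 1] ?_ (by simp) ?_) ?_
      ![3, 2, 1, 0] ?_
    · intro i; fin_cases i <;> simp
    · simp; linarith
    · rw [Matrix.diagonal_mul_diagonal]
      ext i j; fin_cases i <;> fin_cases j <;> simp
    · intro i; ext j; fin_cases i <;> fin_cases j <;> simp [W, Matrix.mulVec_diagonal]

theorem Bd.all {N : Matrix (Fin 3) (Fin 3) ℝ} (h1 : N.transpose * N = 1) : Bd N := by
  have hd : N.det * N.det = 1 := by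
    have := congrArg Matrix.det h1
    simpa using this
  rcases mul_self_eq_one_iff.1 hd with h | h
  · have hs : (!![1, 0, 0; 0, 0, 1; 0, 1, 0] : Matrix (Fin 3) (Fin 3) ℝ) *
        !![1, 0, 0; 0, 0, 1; 0, 1, 0] = 1 := by
      ext i j; fin_cases i <;> fin_cases j <;> simp [Matrix.mul_apply, Fin.sum_univ_three]
    have ht : (!![1, 0, 0; 0, 0, 1; 0, 1, 0] : Matrix (Fin 3) (Fin 3) ℝ).transpose =
        !![1, 0, 0; 0, 0, 1; 0, 1, 0] := by
      ext i j; fin_cases i <;> fin_cases j <;> simp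
    refine Bd.of_perm !![1, 0, 0; 0, 0, 1; 0, 1, 0] (Bd.of_neg ?_ ?_) hs ![0, 1, 3, 2] ?_
    · rw [Matrix.transpose_mul, mul_assoc, ← mul_assoc N.transpose, h1, one_mul, ht, hs]
    · rw [Matrix.det_mul, h, Matrix.det_fin_three]; simp
    · intro i; ext j
      fin_cases i <;> fin_cases j <;> simp [W, Matrix.mulVec, dotProduct, Fin.sum_univ_three]
  · exact Bd.of_neg h1 h


lemma frame_point (u : Fin 3 → ℝ) (hu : u ⬝ᵥ u = 3) :
    ∃ A : Matrix (Fin 3) (Fin 3) ℝ, A.transpose * A = 1 ∧ A.mulVec (W 0) = u := by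
  have hw : W 0 ⬝ᵥ W 0 = 3 := by simp [W]; norm_num
  by_cases hv : W 0 - u = 0
  · exact ⟨1, by simp, by simpa using sub_eq_zero.1 hv⟩
  obtain ⟨v, hvdef⟩ : ∃ v, v = W 0 - u := ⟨_, rfl⟩
  rw [← hvdef] at hv
  have hvv : v ⬝ᵥ v ≠ 0 := fun h => hv (dotProduct_self_eq_zero.1 h)
  have hvw : 2 * (v ⬝ᵥ W 0) = v ⬝ᵥ v := by
    rw [hvdef]
    simp only [sub_dotProduct, dotProduct_sub, hu, hw, dotProduct_comm u (W 0)]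
    ring
  refine ⟨1 - (2 / (v ⬝ᵥ v)) • Matrix.vecMulVec v v, ?_, ?_⟩
  · have ht : (1 - (2 / (v ⬝ᵥ v)) • Matrix.vecMulVec v v).transpose =
        1 - (2 / (v ⬝ᵥ v)) • Matrix.vecMulVec v v := by
      simp [Matrix.transpose_vecMulVec]
    rw [ht]
    simp only [mul_sub, sub_mul, mul_one, one_mul, Matrix.smul_mul, Matrix.mul_smul,
      Matrix.vecMulVec_mul_vecMulVec]
    ext i j
    simp [Matrix.vecMulVec_apply]
    field_simp
    ring
  · rw [Matrix.sub_mulVec, Matrix.one_mulVec, Matrix.smul_mulVec, Matrix.vecMulVec_mulVec]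
    ext j
    simp
    have : u j = W 0 j - v j := by rw [hvdef]; simp
    rw [this]
    field_simp
    rw [← hvw]
    ring

lemma frame (p : Fin 4 → Fin 3 → ℝ) (hp : ∀ i, p i ⬝ᵥ p i = 1) (c : ℝ)
    (hc : ∀ i j, i ≠ j → p i ⬝ᵥ p j = c) :
    ∃ A : Matrix (Fin 3) (Fin 3) ℝ, A.transpose * A = 1 ∧
      ∀ i, ∃ j, √3 • p i = A.mulVec (W j) := by
  have h3 : √3 * √3 = 3 := Real.mul_self_sqrt (by norm_num)
  by_cases h1 : c = 1
  · have hpe : ∀ i, p i = p 0 := by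
      intro i
      by_cases hi : i = 0
      · rw [hi]
      rw [← sub_eq_zero, ← dotProduct_self_eq_zero]
      simp only [sub_dotProduct, dotProduct_sub, hp, hc i 0 hi, hc 0 i (Ne.symm hi), h1]
      norm_num
    obtain ⟨A, hA, hA'⟩ := frame_point (√3 • p 0) (by
      simp only [smul_dotProduct, dotProduct_smul, hp, smul_eq_mul, mul_one, h3])
    exact ⟨A, hA, fun i => ⟨0, by rw [hpe i, hA']⟩⟩
  have hne : 4 - 4 * c ≠ 0 := fun h => h1 (by linarith)
  have e00 := hp 0
  have e11 := hp 1
  have e22 := hp 2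
  have e33 := hp 3
  have e01 := hc 0 1 (by decide)
  have e02 := hc 0 2 (by decide)
  have e03 := hc 0 3 (by decide)
  have e12 := hc 1 2 (by decide)
  have e13 := hc 1 3 (by decide)
  have e23 := hc 2 3 (by decide)
  simp only [dotProduct, Fin.sum_univ_three] at e00 e11 e22 e33 e01 e02 e03 e12 e13 e23
  obtain ⟨F, hF⟩ : ∃ F : Matrix (Fin 3) (Fin 3) ℝ, F = Matrix.of fun k => ![
    p 0 k + p 1 k - p 2 k - p 3 k, p 0 k - p 1 k + p 2 k - p 3 k,
    p 0 k - p 1 k - p 2 k + p 3 k] := ⟨_, rfl⟩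
  have hFF : F.transpose * F = (4 - 4 * c) • 1 := by
    rw [hF]
    ext i j
    fin_cases i <;> fin_cases j <;> simp [Matrix.mul_apply, Fin.sum_univ_three] <;> linarith
  have hFF' : F * F.transpose = (4 - 4 * c) • 1 := by
    have : ((4 - 4 * c)⁻¹ • F.transpose) * F = 1 := by
      rw [Matrix.smul_mul, hFF, smul_smul, inv_mul_cancel₀ hne, one_smul]
    have := mul_eq_one_comm.1 this
    rw [Matrix.mul_smul] at this
    rw [← this, smul_smul, mul_inv_cancel₀ hne, one_smul]
  have hs : p 0 + p 1 + p 2 + p 3 = 0 := by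
    have h0 : F.transpose.mulVec (p 0 + p 1 + p 2 + p 3) = 0 := by
      rw [hF]
      ext i
      fin_cases i <;> simp [Matrix.mulVec, dotProduct, Fin.sum_univ_three] <;> linarith
    have := congrArg F.mulVec h0
    rw [Matrix.mulVec_mulVec, hFF', Matrix.smul_mulVec, Matrix.one_mulVec, Matrix.mulVec_zero] at this
    exact (smul_eq_zero.1 this).resolve_left hne
  have hs0 := congrFun hs 0
  have hs1 := congrFun hs 1
  have hs2 := congrFun hs 2
  simp only [Pi.add_apply, Pi.zero_apply] at hs0 hs1 hs2
  have hc3 : c = -1 / 3 := by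
    have : p 0 ⬝ᵥ (p 0 + p 1 + p 2 + p 3) = 0 := by rw [hs, dotProduct_zero]
    simp only [dotProduct_add, hp, hc 0 1 (by decide), hc 0 2 (by decide), hc 0 3 (by decide)] at this
    linarith
  have hsk : ∀ k, p 0 k + p 1 k + p 2 k + p 3 k = 0 := fun k => congrFun hs k
  refine ⟨(√3 / 4) • F, ?_, fun i => ⟨i, ?_⟩⟩
  · rw [Matrix.transpose_smul, Matrix.smul_mul, Matrix.mul_smul, hFF, smul_smul, smul_smul, hc3]
    rw [show √3 / 4 * (√3 / 4) * (4 - 4 * (-1 / 3)) = 1 by linear_combination h3 / 3, one_smul]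
  · rw [Matrix.smul_mulVec, hF]
    ext k
    have hk := hsk k
    fin_cases i <;> simp [W, Matrix.mulVec, dotProduct, Fin.sum_univ_three]
    · linear_combination (√3 / 4) * hk
    · linear_combination (√3 / 4) * hk
    · linear_combination (√3 / 4) * hk
    · linear_combination (√3 / 4) * hk

lemma frame_E (p : Fin 4 → EuclideanSpace ℝ (Fin 3)) (hp : ∀ i, ‖p i‖ = 1)
    (hpreg : ∀ i j k l, i ≠ j → k ≠ l → dist (p i) (p j) = dist (p k) (p l)) :
    ∃ A : Matrix (Fin 3) (Fin 3) ℝ, A.transpose * A = 1 ∧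
      ∀ i, ∃ j, √3 • (p i).ofLp = A.mulVec (W j) := by
  have hdot : ∀ x y : EuclideanSpace ℝ (Fin 3), x.ofLp ⬝ᵥ y.ofLp = inner ℝ x y := by
    intro x y
    rw [EuclideanSpace.inner_eq_star_dotProduct, dotProduct_comm]
    simp
  refine frame (fun i => (p i).ofLp) ?_ (inner ℝ (p 0) (p 1)) ?_
  · intro i
    rw [hdot, real_inner_self_eq_norm_sq, hp]; norm_num
  · intro i j hij
    rw [hdot]
    have h := hpreg i j 0 1 hij (by decide)
    rw [dist_eq_norm, dist_eq_norm] at h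
    have h1 := norm_sub_sq_real (p i) (p j)
    have h2 := norm_sub_sq_real (p 0) (p 1)
    rw [h, h2] at h1
    simp only [hp] at h1
    linarith

open scoped Pointwise in
theorem aux_two_regular_tetrahedra_cube_bound
    (p q : Fin 4 → EuclideanSpace ℝ (Fin 3))
    (hp : ∀ i, ‖p i‖ = 1) (hq : ∀ i, ‖q i‖ = 1)
    (hpreg : ∀ i j k l, i ≠ j → k ≠ l → dist (p i) (p j) = dist (p k) (p l))
    (hqreg : ∀ i j k l, i ≠ j → k ≠ l → dist (q i) (q j) = dist (q k) (q l)) :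
    (volume (convexHull ℝ (Set.range p ∪ Set.range q))).toReal ≤ 8 / (3 * Real.sqrt 3) := by
  obtain ⟨A, hA, hAp⟩ := frame_E p hp hpreg
  obtain ⟨B, hB, hBq⟩ := frame_E q hq hqreg
  have hA' : A * A.transpose = 1 := mul_eq_one_comm.1 hA
  have hB' : B * B.transpose = 1 := mul_eq_one_comm.1 hB
  have h3 : √3 * √3 = 3 := Real.mul_self_sqrt (by norm_num)
  have h3p : 0 < √3 := by positivity
  obtain ⟨T, hT⟩ : ∃ T : Set (Fin 3 → ℝ),
    T = Set.range (fun i => (p i).ofLp) ∪ Set.range (fun i => (q i).ofLp) := ⟨_, rfl⟩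
  -- transfer to coordinates
  have hvol : volume (convexHull ℝ (Set.range p ∪ Set.range q)) = volume (convexHull ℝ T) := by
    have hmp : MeasurePreserving (MeasurableEquiv.toLp 2 (Fin 3 → ℝ)).symm volume volume :=
      PiLp.volume_preserving_ofLp (Fin 3)
    have hpre := hmp.measure_preimage_equiv (convexHull ℝ T)
    rw [← hpre]
    congr 1
    have him : T = (WithLp.linearEquiv 2 ℝ (Fin 3 → ℝ)).toLinearMap ''
        (Set.range p ∪ Set.range q) := by
      rw [hT, Set.image_union, ← Set.range_comp, ← Set.range_comp]
      rfl
    rw [him, ← LinearMap.image_convexHull]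
    exact (Set.preimage_image_eq _ (WithLp.linearEquiv 2 ℝ (Fin 3 → ℝ)).injective).symm
  have hdet : |A.det| = 1 := by
    have := congrArg Matrix.det hA
    rw [Matrix.det_mul, Matrix.det_transpose, Matrix.det_one] at this
    rcases mul_self_eq_one_iff.1 this with h | h <;> simp [h]
  have hb : volume (convexHull ℝ (√3 • T)) ≤ ENNReal.ofReal 8 := by
    have hN : Bd (A.transpose * B) := by
      apply Bd.all
      rw [Matrix.transpose_mul, Matrix.transpose_transpose, mul_assoc, ← mul_assoc A, hA', one_mul,
        hB]
    refine le_trans (vol_hull_le A hdet ?_) hN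
    rw [hT, Set.smul_set_union, Set.smul_set_range, Set.smul_set_range]
    rintro _ (⟨i, rfl⟩ | ⟨i, rfl⟩)
    · obtain ⟨j, hj⟩ := hAp i
      exact ⟨W j, Or.inl ⟨j, rfl⟩, hj.symm⟩
    · obtain ⟨j, hj⟩ := hBq i
      refine ⟨_, Or.inr ⟨j, rfl⟩, ?_⟩
      simp only
      rw [Matrix.mulVec_mulVec, ← mul_assoc, hA', one_mul, hj]
  have hfr : Module.finrank ℝ (Fin 3 → ℝ) = 3 := by simp
  rw [convexHull_smul, Measure.addHaar_smul, hfr, abs_of_pos (pow_pos h3p 3)] at hb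
  rw [hvol]
  have hb2 := ENNReal.toReal_le_of_le_ofReal (by norm_num) hb
  rw [ENNReal.toReal_mul, ENNReal.toReal_ofReal (pow_pos h3p 3).le] at hb2
  rw [le_div_iff₀ (by positivity)]
  have : √3 ^ 3 = 3 * √3 := by rw [pow_succ, pow_two, h3]
  rw [this] at hb2
  linarith

/-- G.Horváth: the convex hull of the vertices of two regular tetrahedra inscribed in the
unit sphere of Euclidean 3-space has volume at most `8/(3√3)`, the volume of a cube
inscribed in the unit sphere. -/
theorem two_regular_tetrahedra_cube_bound
    (p q : Fin 4 → EuclideanSpace ℝ (Fin 3))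
    (hp : ∀ i, ‖p i‖ = 1) (hq : ∀ i, ‖q i‖ = 1)
    (hpreg : ∀ i j k l, i ≠ j → k ≠ l → dist (p i) (p j) = dist (p k) (p l))
    (hqreg : ∀ i j k l, i ≠ j → k ≠ l → dist (q i) (q j) = dist (q k) (q l)) :
    (volume (convexHull ℝ (Set.range p ∪ Set.range q))).toReal ≤ 8 / (3 * Real.sqrt 3) := by
  exact aux_two_regular_tetrahedra_cube_bound p q hp hq hpreg hqreg
end

section
/- (Rogers–Shephard) Let H and K be convex bodies in EuclideanSpace ℝ (Fin d). For convex bodies A, B define V*(A,B) = sup { vol(convexHull ℝ (A ∪ (x +ᵥ B))) : x ∈ EuclideanSpace ℝ (Fin d), A ∩ (x +ᵥ B) ≠ ∅ }. Let S_H and S_K be closed balls centered at the origin with vol(S_H) = vol(H) and vol(S_K) = vol(K). Then V*(H,K) ≥ V*(S_H, S_K). -/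
open MeasureTheory Pointwise

/-- `maxHullVol A B` is the supremum, over all translation vectors `x` for which `A` meets
`x +ᵥ B`, of the volume of the convex hull of `A ∪ (x +ᵥ B)`. -/
noncomputable def maxHullVol {d : ℕ} (A B : Set (EuclideanSpace ℝ (Fin d))) : ℝ :=
  sSup {v : ℝ | ∃ x : EuclideanSpace ℝ (Fin d), (A ∩ (x +ᵥ B)).Nonempty ∧
    v = (volume (convexHull ℝ (A ∪ (x +ᵥ B)))).toReal}


namespace RS

open Set

/-- Euclidean space. -/
abbrev Eu (d : ℕ) := EuclideanSpace ℝ (Fin d)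

/-- Reflection in the hyperplane orthogonal to `u`. -/
noncomputable def rf {d : ℕ} (u : Eu d) : Eu d ≃ₗᵢ[ℝ] Eu d :=
  (Submodule.span ℝ {u})ᗮ.reflection

/-- Fibrewise Minkowski average in the direction `u`. -/
def avg {d : ℕ} (u : Eu d) (A B : Set (Eu d)) : Set (Eu d) :=
  {y | ∃ z ∈ A, ∃ w ∈ B, z - w ∈ Submodule.span ℝ {u} ∧ y = (1 / 2 : ℝ) • (z + w)}

/-- Steiner symmetrization. -/
def St {d : ℕ} (u : Eu d) (A : Set (Eu d)) : Set (Eu d) := avg u A (rf u '' A)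

lemma avg_eq_image {d : ℕ} (u : Eu d) (A B : Set (Eu d)) :
    avg u A B = (fun p : Eu d × Eu d => (1 / 2 : ℝ) • (p.1 + p.2)) ''
      ((A ×ˢ B) ∩ {p | p.1 - p.2 ∈ Submodule.span ℝ {u}}) := by
  ext y
  constructor
  · rintro ⟨z, hz, w, hw, h, rfl⟩
    exact ⟨(z, w), ⟨⟨hz, hw⟩, h⟩, rfl⟩
  · rintro ⟨⟨z, w⟩, ⟨⟨hz, hw⟩, h⟩, rfl⟩
    exact ⟨z, hz, w, hw, h, rfl⟩

lemma avg_compact {d : ℕ} (u : Eu d) {A B : Set (Eu d)} (hA : IsCompact A) (hB : IsCompact B) :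
    IsCompact (avg u A B) := by
  rw [avg_eq_image]
  apply IsCompact.image _ (by fun_prop)
  apply (hA.prod hB).inter_right
  exact (Submodule.closed_of_finiteDimensional (Submodule.span ℝ {u})).preimage
    (continuous_fst.sub continuous_snd)

lemma avg_convex {d : ℕ} (u : Eu d) {A B : Set (Eu d)} (hA : Convex ℝ A) (hB : Convex ℝ B) :
    Convex ℝ (avg u A B) := by
  rintro _ ⟨z, hz, w, hw, h, rfl⟩ _ ⟨z', hz', w', hw', h', rfl⟩ a b ha hb hab
  refine ⟨a • z + b • z', hA hz hz' ha hb hab, a • w + b • w', hB hw hw' ha hb hab, ?_, ?_⟩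
  · have : a • z + b • z' - (a • w + b • w') = a • (z - w) + b • (z' - w') := by module
    rw [this]
    exact Submodule.add_mem _ (Submodule.smul_mem _ _ h) (Submodule.smul_mem _ _ h')
  · module

lemma sub_rf {d : ℕ} (u z : Eu d) : z - rf u z ∈ Submodule.span ℝ {u} := by
  have : z - rf u z = (2:ℝ) • ((Submodule.span ℝ {u}).starProjection z) := by
    rw [rf, Submodule.reflection_orthogonal_apply, Submodule.reflection_apply]
    module
  rw [this]
  exact Submodule.smul_mem _ _ (Submodule.starProjection_apply_mem _ _)

/-- The one dimensional statement. -/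
lemma interval_avg {I J : Set ℝ} (hI : IsCompact I) (hJ : IsCompact J) (hIc : Convex ℝ I)
    (hJc : Convex ℝ J) (h : I.Nonempty ↔ J.Nonempty) :
    2 * volume {s : ℝ | ∃ a ∈ I, ∃ b ∈ J, s = (1 / 2) * (a + b)} = volume I + volume J := by
  rcases I.eq_empty_or_nonempty with rfl | hne
  · have : J = ∅ := by
      by_contra hJ
      simpa using h.2 (nonempty_iff_ne_empty.2 hJ)
    subst this
    simp
  have hne' := h.1 hne
  have e1 := eq_Icc_of_connected_compact ⟨hne, hIc.isPreconnected⟩ hI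
  have e2 := eq_Icc_of_connected_compact ⟨hne', hJc.isPreconnected⟩ hJ
  have l1 := Real.sInf_le_sSup I hI.bddBelow hI.bddAbove
  have l2 := Real.sInf_le_sSup J hJ.bddBelow hJ.bddAbove
  revert l1 l2 e1 e2
  generalize sInf I = a
  generalize sSup I = b
  generalize sInf J = a'
  generalize sSup J = b'
  rintro rfl rfl l1 l2
  have : {s : ℝ | ∃ x ∈ Icc a b, ∃ y ∈ Icc a' b', s = (1 / 2) * (x + y)}
      = Icc ((a + a') / 2) ((b + b') / 2) := by
    ext s
    constructor
    · rintro ⟨x, hx, y, hy, rfl⟩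
      constructor <;> linarith [hx.1, hx.2, hy.1, hy.2]
    · rintro ⟨h1, h2⟩
      rcases le_total (2 * s) (a + b') with hs | hs
      · exact ⟨a, ⟨le_rfl, l1⟩, 2 * s - a, ⟨by linarith, by linarith⟩, by ring⟩
      · exact ⟨2 * s - b', ⟨by linarith, by linarith⟩, b', ⟨l2, le_rfl⟩, by ring⟩
  rw [this, Real.volume_Icc, Real.volume_Icc, Real.volume_Icc,
    ← ENNReal.ofReal_add (by linarith) (by linarith), ← ENNReal.ofReal_ofNat,
    ← ENNReal.ofReal_mul (by norm_num)]
  congr 1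
  ring

/-- Fubini along the direction of a unit vector `u`. -/
lemma exists_fiber {n : ℕ} (u : Eu (n + 1)) (hu : ‖u‖ = 1) :
    ∃ φ : (Fin n → ℝ) → ℝ → Eu (n + 1), (∀ p, Continuous (φ p)) ∧
      (∀ p s t, φ p t = φ p s + (t - s) • u) ∧
      ∀ A : Set (Eu (n + 1)), MeasurableSet A →
        Measurable (fun p => volume {s | φ p s ∈ A}) ∧
        volume A = ∫⁻ p, volume {s | φ p s ∈ A} := by
  obtain ⟨b, hb⟩ := Orthonormal.exists_orthonormalBasis_extension_of_card_eq (𝕜 := ℝ)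
    (E := Eu (n + 1)) (ι := Fin (n + 1)) (by simp) (v := fun _ => u) (s := {0}) (by
      constructor
      · intro i; simpa using hu
      · intro i j hij
        exact absurd (Subsingleton.elim i j) hij)
  have hb0 : b 0 = u := hb 0 rfl
  have mp := (b.measurePreserving_repr_symm.comp (PiLp.volume_preserving_toLp (Fin (n + 1)))).comp
      (volume_preserving_piFinSuccAbove (fun _ : Fin (n + 1) => ℝ) 0).symm
  have hF : ((b.repr.symm ∘ WithLp.toLp 2) ∘
      (MeasurableEquiv.piFinSuccAbove (fun _ : Fin (n + 1) => ℝ) 0).symm) =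
      fun q : ℝ × (Fin n → ℝ) => b.repr.symm (WithLp.toLp 2 (Fin.cons q.1 q.2)) := by
    funext q
    simp [MeasurableEquiv.piFinSuccAbove, Fin.insertNthEquiv]
  rw [hF] at mp
  refine ⟨fun p s => b.repr.symm (WithLp.toLp 2 (Fin.cons s p)), ?_, ?_, ?_⟩
  · intro p
    have : Continuous fun s : ℝ => (Fin.cons s p : Fin (n + 1) → ℝ) :=
      continuous_pi fun i => by
        refine Fin.cases ?_ (fun j => ?_) i
        · exact continuous_id
        · simpa using continuous_const
    exact b.repr.symm.continuous.comp ((PiLp.continuous_toLp 2 _).comp this)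
  · intro p s t
    have : (WithLp.toLp 2 (Fin.cons t p) : Eu (n + 1))
        = WithLp.toLp 2 (Fin.cons s p) + (t - s) • EuclideanSpace.single 0 1 := by
      ext i
      refine Fin.cases ?_ (fun j => ?_) i
      · simp
      · simp
    show b.repr.symm _ = _
    rw [this, map_add, map_smul, ← hb0, b.repr_symm_single]
  · intro A hA
    refine ⟨measurable_measure_prodMk_right (μ := (volume : Measure ℝ)) (mp.measurable hA), ?_⟩
    rw [← mp.measure_preimage hA.nullMeasurableSet, Measure.volume_eq_prod,
      Measure.prod_apply_symm (mp.measurable hA)]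
    rfl

lemma vol_avg_unit {n : ℕ} (u : Eu (n + 1)) (hu : ‖u‖ = 1) {A B : Set (Eu (n + 1))}
    (hA : IsCompact A) (hB : IsCompact B) (hAc : Convex ℝ A) (hBc : Convex ℝ B)
    (h1 : ∀ z ∈ A, ∃ w ∈ B, z - w ∈ Submodule.span ℝ {u})
    (h2 : ∀ w ∈ B, ∃ z ∈ A, z - w ∈ Submodule.span ℝ {u}) :
    2 * volume (avg u A B) = volume A + volume B := by
  obtain ⟨φ, hφc, hφ, hvol⟩ := exists_fiber u hu
  have u0 : u ≠ 0 := by rintro rfl; simp at hu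
  have hdiff : ∀ p s t, φ p s - φ p t ∈ Submodule.span ℝ {u} := by
    intro p s t
    rw [hφ p t s, add_sub_cancel_left]
    exact Submodule.smul_mem _ _ (Submodule.mem_span_singleton_self u)
  have hon : ∀ p s w, φ p s - w ∈ Submodule.span ℝ {u} → ∃ t, w = φ p t := by
    intro p s w h
    obtain ⟨c, hc⟩ := Submodule.mem_span_singleton.1 h
    refine ⟨s - c, ?_⟩
    rw [hφ p s (s - c), show s - c - s = -c by ring, neg_smul, hc]
    abel
  have hinj : ∀ p, Function.Injective (φ p) := by
    intro p s t hst
    rw [hφ p s t] at hst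
    have : (t - s) • u = 0 := by simpa using hst
    rcases smul_eq_zero.1 this with h | h
    · linarith
    · exact absurd h u0
  have hcomp : ∀ p (C : Set (Eu (n + 1))), IsCompact C → IsCompact {s | φ p s ∈ C} := by
    intro p C hC
    refine Metric.isCompact_of_isClosed_isBounded (hC.isClosed.preimage (hφc p)) ?_
    obtain ⟨R, hR⟩ := hC.isBounded.exists_norm_le
    refine (Metric.isBounded_iff_subset_closedBall 0).2 ⟨R + ‖φ p 0‖, fun s hs => ?_⟩
    have e := hφ p 0 s
    have : s • u = φ p s - φ p 0 := by rw [e]; simp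
    have h3 : ‖s • u‖ = |s| := by rw [norm_smul, hu, mul_one, Real.norm_eq_abs]
    rw [mem_closedBall_zero_iff, Real.norm_eq_abs, ← h3, this]
    exact (norm_sub_le _ _).trans (by gcongr; exact hR _ hs)
  have hconv : ∀ p (C : Set (Eu (n + 1))), Convex ℝ C → Convex ℝ {s | φ p s ∈ C} := by
    intro p C hC s hs t ht a b ha hb hab
    have : φ p (a • s + b • t) = a • φ p s + b • φ p t := by
      rw [hφ p 0 (a • s + b • t), hφ p 0 s, hφ p 0 t]
      have : φ p 0 = (a + b) • φ p 0 := by rw [hab, one_smul]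
      nth_rewrite 1 [this]
      simp only [smul_eq_mul, sub_zero]
      module
    show φ p _ ∈ C
    rw [this]
    exact hC hs ht ha hb hab
  have hmeas : ∀ C : Set (Eu (n + 1)), IsCompact C → MeasurableSet C := fun C hC => hC.measurableSet
  rw [(hvol A (hmeas A hA)).2, (hvol B (hmeas B hB)).2,
    (hvol _ (hmeas _ (avg_compact u hA hB))).2]
  have key : ∀ p, 2 * volume {s | φ p s ∈ avg u A B}
      = volume {s | φ p s ∈ A} + volume {s | φ p s ∈ B} := by
    intro p
    rw [← interval_avg (hcomp p A hA) (hcomp p B hB) (hconv p A hAc) (hconv p B hBc)]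
    · congr 2
      have mid : ∀ s t, (1 / 2 : ℝ) • (φ p s + φ p t) = φ p ((1 / 2) * (s + t)) := by
        intro s t
        rw [hφ p 0 ((1 / 2) * (s + t)), hφ p 0 s, hφ p 0 t]
        module
      ext s
      constructor
      · rintro ⟨z, hz, w, hw, h, e⟩
        have : φ p s - z ∈ Submodule.span ℝ {u} := by
          rw [e, show (1 / 2 : ℝ) • (z + w) - z = (-(1 / 2) : ℝ) • (z - w) by module]
          exact Submodule.smul_mem _ _ h
        obtain ⟨a, rfl⟩ := hon p s z this
        obtain ⟨b, rfl⟩ := hon p a w h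
        rw [mid] at e
        exact ⟨a, hz, b, hw, hinj p e⟩
      · rintro ⟨a, ha, b, hb, rfl⟩
        exact ⟨_, ha, _, hb, hdiff p a b, (mid a b).symm⟩
    · constructor
      · rintro ⟨s, hs⟩
        obtain ⟨w, hw, h⟩ := h1 _ hs
        obtain ⟨t, rfl⟩ := hon p s w h
        exact ⟨t, hw⟩
      · rintro ⟨s, hs⟩
        obtain ⟨w, hw, h⟩ := h2 _ hs
        obtain ⟨t, rfl⟩ := hon p s w (by rw [← neg_sub]; exact Submodule.neg_mem _ h)
        exact ⟨t, hw⟩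
  rw [← lintegral_const_mul' _ _ (by simp), ← lintegral_add_left (hvol A (hmeas A hA)).1]
  exact lintegral_congr key

lemma vol_avg {d : ℕ} (u : Eu d) {A B : Set (Eu d)}
    (hA : IsCompact A) (hB : IsCompact B) (hAc : Convex ℝ A) (hBc : Convex ℝ B)
    (h1 : ∀ z ∈ A, ∃ w ∈ B, z - w ∈ Submodule.span ℝ {u})
    (h2 : ∀ w ∈ B, ∃ z ∈ A, z - w ∈ Submodule.span ℝ {u}) :
    2 * volume (avg u A B) = volume A + volume B := by
  by_cases hu : u = 0
  · subst hu
    simp only [Submodule.span_zero_singleton, Submodule.mem_bot, sub_eq_zero] at h1 h2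
    have hAB : A = B := by
      ext z
      constructor
      · intro hz
        obtain ⟨w, hw, rfl⟩ := h1 z hz
        exact hw
      · intro hz
        obtain ⟨w, hw, rfl⟩ := h2 z hz
        exact hw
    subst hAB
    have : avg 0 A A = A := by
      ext z
      constructor
      · rintro ⟨z, hz, w, hw, h, rfl⟩
        simp only [Submodule.span_zero_singleton, Submodule.mem_bot, sub_eq_zero] at h
        subst h
        rw [show (1 / 2 : ℝ) • (z + z) = z by module]
        exact hz
      · intro hz
        exact ⟨z, hz, z, hz, by simp, by module⟩
    rw [this, two_mul]
  · obtain ⟨n, rfl⟩ : ∃ n, d = n + 1 := by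
      rcases d with _ | n
      · exact absurd (Subsingleton.elim u 0) hu
      · exact ⟨n, rfl⟩
    have hn : ‖u‖ ≠ 0 := norm_ne_zero_iff.2 hu
    have hs : Submodule.span ℝ {u} = Submodule.span ℝ {(‖u‖⁻¹ : ℝ) • u} :=
      (Submodule.span_singleton_smul_eq (IsUnit.mk0 _ (inv_ne_zero hn)) u).symm
    have e : avg u A B = avg ((‖u‖⁻¹ : ℝ) • u) A B := by
      unfold avg
      rw [hs]
    rw [hs] at h1 h2
    rw [e]
    exact vol_avg_unit _ (by rw [norm_smul, norm_inv, norm_norm, inv_mul_cancel₀ hn])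
      hA hB hAc hBc h1 h2

lemma rf_rf {d : ℕ} (u z : Eu d) : rf u (rf u z) = z :=
  Submodule.reflection_reflection _ _

lemma vol_rf {d : ℕ} (u : Eu d) (A : Set (Eu d)) : volume (rf u '' A) = volume A :=
  by
  rw [LinearIsometryEquiv.image_eq_preimage_symm]
  exact (rf u).symm.measurePreserving.measure_preimage_emb
    (rf u).symm.toHomeomorph.measurableEmbedding A

lemma rf_convex {d : ℕ} (u : Eu d) {A : Set (Eu d)} (hA : Convex ℝ A) : Convex ℝ (rf u '' A) :=
  hA.linear_image (rf u).toLinearEquiv.toLinearMap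

lemma rf_compact {d : ℕ} (u : Eu d) {A : Set (Eu d)} (hA : IsCompact A) : IsCompact (rf u '' A) :=
  hA.image (rf u).continuous

lemma St_compact {d : ℕ} (u : Eu d) {A : Set (Eu d)} (hA : IsCompact A) : IsCompact (St u A) :=
  avg_compact u hA (rf_compact u hA)

lemma St_convex {d : ℕ} (u : Eu d) {A : Set (Eu d)} (hA : Convex ℝ A) : Convex ℝ (St u A) :=
  avg_convex u hA (rf_convex u hA)

lemma St_nonempty {d : ℕ} (u : Eu d) {A : Set (Eu d)} (hA : A.Nonempty) : (St u A).Nonempty := by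
  obtain ⟨z, hz⟩ := hA
  exact ⟨_, z, hz, _, ⟨z, hz, rfl⟩, sub_rf u z, rfl⟩

lemma vol_St {d : ℕ} (u : Eu d) {A : Set (Eu d)} (hA : IsCompact A) (hAc : Convex ℝ A) :
    volume (St u A) = volume A := by
  have := vol_avg u hA (rf_compact u hA) hAc (rf_convex u hAc)
    (fun z hz => ⟨_, ⟨z, hz, rfl⟩, sub_rf u z⟩)
    (by rintro _ ⟨z, hz, rfl⟩; exact ⟨z, hz, sub_rf u z⟩)
  rw [vol_rf, ← two_mul] at this
  exact (ENNReal.mul_right_inj (by simp) (by simp)).1 this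

/-- All hulls of meeting translates have volume at most `V`. -/
def Good {d : ℕ} (V : ENNReal) (A B : Set (Eu d)) : Prop :=
  ∀ x : Eu d, (A ∩ (x +ᵥ B)).Nonempty → volume (convexHull ℝ (A ∪ (x +ᵥ B))) ≤ V

lemma compact_vadd {d : ℕ} (x : Eu d) {B : Set (Eu d)} (hB : IsCompact B) :
    IsCompact (x +ᵥ B) := hB.vadd x

lemma compact_hull {d : ℕ} {A B : Set (Eu d)} (hA : IsCompact A) (hB : IsCompact B)
    (hAc : Convex ℝ A) (hBc : Convex ℝ B) (hA0 : A.Nonempty) (hB0 : B.Nonempty) :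
    IsCompact (convexHull ℝ (A ∪ B)) := by
  rw [hAc.convexHull_union hBc hA0 hB0]
  have : convexJoin ℝ A B = (fun p : (Eu d × Eu d) × ℝ => (1 - p.2) • p.1.1 + p.2 • p.1.2) ''
      ((A ×ˢ B) ×ˢ Icc (0 : ℝ) 1) := by
    ext y
    rw [mem_convexJoin]
    constructor
    · rintro ⟨a, ha, b, hb, h⟩
      rw [segment_eq_image] at h
      obtain ⟨t, ht, rfl⟩ := h
      exact ⟨((a, b), t), ⟨⟨ha, hb⟩, ht⟩, rfl⟩
    · rintro ⟨⟨⟨a, b⟩, t⟩, ⟨⟨ha, hb⟩, ht⟩, rfl⟩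
      refine ⟨a, ha, b, hb, ?_⟩
      rw [segment_eq_image]
      exact ⟨t, ht, rfl⟩
  rw [this]
  exact ((hA.prod hB).prod isCompact_Icc).image (by fun_prop)

lemma convex_sat {d : ℕ} (L : Submodule ℝ (Eu d)) {C : Set (Eu d)} (hC : Convex ℝ C) :
    Convex ℝ {z | ∃ w ∈ C, z - w ∈ L} := by
  rintro z ⟨w, hw, h⟩ z' ⟨w', hw', h'⟩ a b ha hb hab
  refine ⟨_, hC hw hw' ha hb hab, ?_⟩
  have : a • z + b • z' - (a • w + b • w') = a • (z - w) + b • (z' - w') := by module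
  rw [this]
  exact Submodule.add_mem _ (Submodule.smul_mem _ _ h) (Submodule.smul_mem _ _ h')

lemma good_St {d : ℕ} {V : ENNReal} (u : Eu d) {A B : Set (Eu d)} (hA : IsCompact A)
    (hB : IsCompact B) (hAc : Convex ℝ A) (hBc : Convex ℝ B) (hV : Good V A B) : Good V (St u A) (St u B) := by
  rintro x ⟨p, ⟨z, hz, _, ⟨w, hw, rfl⟩, hzw, hp⟩, hpx⟩
  obtain ⟨q, ⟨z', hz', _, ⟨w', hw', rfl⟩, hzw', hq⟩, hqp⟩ := hpx
  set y1 := z - z' with hy1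
  set y2 := w - w' with hy2
  have hL : y1 - rf u y2 ∈ Submodule.span ℝ {u} := by
    have : y1 - rf u y2 = (z - rf u w) - (z' - rf u w') := by
      rw [hy1, hy2, map_sub]; abel
    rw [this]
    exact Submodule.sub_mem _ hzw hzw'
  have hx : x = (1 / 2 : ℝ) • (y1 + rf u y2) := by
    have : x = p - q := by
      rw [← hqp]; simp
    rw [this, hp, hq, hy1, hy2, map_sub]
    module
  set C1 := convexHull ℝ (A ∪ (y1 +ᵥ B)) with hC1
  set C2 := convexHull ℝ (A ∪ (y2 +ᵥ B)) with hC2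
  have v1 : volume C1 ≤ V := hV y1 ⟨z, hz, z', hz', by simp [hy1]⟩
  have v2 : volume C2 ≤ V := hV y2 ⟨w, hw, w', hw', by simp [hy2]⟩
  have c1 : IsCompact C1 := compact_hull hA (compact_vadd _ hB) hAc (hBc.vadd _)
    ⟨z, hz⟩ (Set.Nonempty.vadd_set ⟨z', hz'⟩)
  have c2 : IsCompact C2 := compact_hull hA (compact_vadd _ hB) hAc (hBc.vadd _)
    ⟨z, hz⟩ (Set.Nonempty.vadd_set ⟨z', hz'⟩)
  have k1 : Convex ℝ C1 := convex_convexHull _ _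
  have k2 : Convex ℝ C2 := convex_convexHull _ _
  have A1 : A ⊆ C1 := subset_union_left.trans (subset_convexHull _ _)
  have A2 : A ⊆ C2 := subset_union_left.trans (subset_convexHull _ _)
  have B1 : ∀ b ∈ B, y1 + b ∈ C1 := fun b hb =>
    subset_convexHull _ _ (Or.inr ⟨b, hb, rfl⟩)
  have B2 : ∀ b ∈ B, y2 + b ∈ C2 := fun b hb =>
    subset_convexHull _ _ (Or.inr ⟨b, hb, rfl⟩)
  have hyb : ∀ b b', b - rf u b' ∈ Submodule.span ℝ {u} →
      (y1 + b) - rf u (y2 + b') ∈ Submodule.span ℝ {u} := by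
    intro b b' h
    have : (y1 + b) - rf u (y2 + b') = (y1 - rf u y2) + (b - rf u b') := by
      rw [map_add]; abel
    rw [this]
    exact Submodule.add_mem _ hL h
  have s1 : ∀ z ∈ C1, ∃ w ∈ rf u '' C2, z - w ∈ Submodule.span ℝ {u} := by
    refine convexHull_min ?_ (convex_sat _ (rf_convex u k2))
    rintro z (hz | ⟨b, hb, rfl⟩)
    · exact ⟨_, ⟨z, A2 hz, rfl⟩, sub_rf u z⟩
    · exact ⟨_, ⟨_, B2 b hb, rfl⟩, hyb b b (sub_rf u b)⟩
  have s2' : ∀ w ∈ C2, ∃ z ∈ rf u '' C1, w - z ∈ Submodule.span ℝ {u} := by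
    refine convexHull_min ?_ (convex_sat _ (rf_convex u k1))
    rintro z (hz | ⟨b, hb, rfl⟩)
    · exact ⟨_, ⟨z, A1 hz, rfl⟩, sub_rf u z⟩
    · refine ⟨_, ⟨_, B1 b hb, rfl⟩, ?_⟩
      have e : (y2 + b) - rf u (y1 + b) = ((y2 + b) - rf u (y2 + b))
        - ((y1 + b) - rf u (y2 + b)) + ((y1 + b) - rf u (y1 + b))  := by abel
      show (y2 + b) - rf u (y1 + b) ∈ _
      rw [e]
      -- combine
      have e2 : (y2 + b) - rf u (y2 + b) - ((y1 + b) - rf u (y2 + b))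
        + ((y1 + b) - rf u (y1 + b)) ∈ Submodule.span ℝ {u} :=
        Submodule.add_mem _ (Submodule.sub_mem _ (sub_rf u _) (hyb b b (sub_rf u b))) (sub_rf u _)
      exact e2
  have s2 : ∀ w ∈ rf u '' C2, ∃ z ∈ C1, z - w ∈ Submodule.span ℝ {u} := by
    rintro _ ⟨w, hw, rfl⟩
    obtain ⟨_, ⟨z, hz, rfl⟩, h⟩ := s2' w hw
    refine ⟨z, hz, ?_⟩
    have e : z - rf u w = (z - rf u z) - (w - rf u z) + (w - rf u w) := by abel
    rw [e]
    exact Submodule.add_mem _ (Submodule.sub_mem _ (sub_rf u _) h) (sub_rf u _)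
  have hvol := vol_avg u c1 (rf_compact u c2) k1 (rf_convex u k2) s1 s2
  rw [vol_rf] at hvol
  have hD : volume (avg u C1 (rf u '' C2)) ≤ V := by
    have : 2 * volume (avg u C1 (rf u '' C2)) ≤ 2 * V := by
      rw [hvol, two_mul]
      exact add_le_add v1 v2
    exact (ENNReal.mul_le_mul_iff_right (by simp) (by simp)).1 this
  refine le_trans (measure_mono ?_) hD
  refine convexHull_min ?_ (avg_convex u k1 (rf_convex u k2))
  rintro _ (⟨z, hz, _, ⟨w, hw, rfl⟩, h, rfl⟩ | ⟨_, ⟨b, hb, _, ⟨b', hb', rfl⟩, h, rfl⟩, rfl⟩)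
  · exact ⟨z, A1 hz, _, ⟨w, A2 hw, rfl⟩, h, rfl⟩
  · refine ⟨_, B1 b hb, _, ⟨_, B2 b' hb', rfl⟩, hyb b b' h, ?_⟩
    show x + _ = _
    rw [hx, map_add]
    module

/-- The contact set with the sphere shrinks. -/
lemma St_contact {d : ℕ} (u : Eu d) {A : Set (Eu d)} {r : ℝ} (hA : A ⊆ Metric.closedBall 0 r) :
    St u A ⊆ Metric.closedBall 0 r ∧ ∀ z ∈ St u A, ‖z‖ = r → z ∈ A ∧ rf u z ∈ A := by
  have key : ∀ z ∈ A, ∀ w ∈ A, ‖z‖ ≤ r ∧ ‖rf u w‖ ≤ r := by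
    intro z hz w hw
    have h1 := hA hz
    have h2 := hA hw
    rw [mem_closedBall_zero_iff] at h1 h2
    exact ⟨h1, by rwa [LinearIsometryEquiv.norm_map]⟩
  constructor
  · rintro _ ⟨z, hz, _, ⟨w, hw, rfl⟩, -, rfl⟩
    obtain ⟨h1, h2⟩ := key z hz w hw
    rw [mem_closedBall_zero_iff, norm_smul]
    have := norm_add_le z (rf u w)
    norm_num
    linarith
  · rintro _ ⟨z, hz, _, ⟨w, hw, rfl⟩, -, rfl⟩ hr
    obtain ⟨h1, h2⟩ := key z hz w hw
    have e : z = rf u w := by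
      have p := parallelogram_law_with_norm ℝ z (rf u w)
      have hr' : ‖z + rf u w‖ = 2 * r := by
        rw [norm_smul] at hr
        norm_num at hr
        linarith
      have : ‖z - rf u w‖ = 0 := by
        rw [hr'] at p
        have h3 : ‖z‖ * ‖z‖ ≤ r * r := mul_self_le_mul_self (norm_nonneg _) h1
        have h4 : ‖rf u w‖ * ‖rf u w‖ ≤ r * r := mul_self_le_mul_self (norm_nonneg _) h2
        nlinarith [norm_nonneg (z - rf u w)]
      exact sub_eq_zero.1 (norm_eq_zero.1 this)
    have e2 : (1 / 2 : ℝ) • (z + rf u w) = z := by rw [← e]; module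
    rw [e2]
    refine ⟨hz, ?_⟩
    rw [e, rf_rf]
    exact hw


/-- Iterated Steiner symmetrization. -/
def iter {d : ℕ} (l : List (Eu d)) (A : Set (Eu d)) : Set (Eu d) := l.foldr St A

lemma iter_props {d : ℕ} {A : Set (Eu d)} (hA : IsCompact A) (hAc : Convex ℝ A)
    (hA0 : A.Nonempty) (l : List (Eu d)) :
    IsCompact (iter l A) ∧ Convex ℝ (iter l A) ∧ (iter l A).Nonempty ∧
      volume (iter l A) = volume A := by
  induction l with
  | nil => exact ⟨hA, hAc, hA0, rfl⟩
  | cons u l ih =>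
    obtain ⟨h1, h2, h3, h4⟩ := ih
    exact ⟨St_compact u h1, St_convex u h2, St_nonempty u h3, (vol_St u h1 h2).trans h4⟩

lemma iter_good {d : ℕ} {V : ENNReal} {A B : Set (Eu d)} (hA : IsCompact A) (hAc : Convex ℝ A)
    (hA0 : A.Nonempty) (hB : IsCompact B) (hBc : Convex ℝ B) (hB0 : B.Nonempty)
    (hV : Good V A B) (l : List (Eu d)) : Good V (iter l A) (iter l B) := by
  induction l with
  | nil => exact hV
  | cons u l ih =>
    obtain ⟨h1, h2, h3, h4⟩ := iter_props hA hAc hA0 l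
    obtain ⟨g1, g2, g3, g4⟩ := iter_props hB hBc hB0 l
    exact good_St u h1 g1 h2 g2 ih

lemma iter_contact {d : ℕ} {A : Set (Eu d)} {r : ℝ} (hA : A ⊆ Metric.closedBall 0 r)
    (l : List (Eu d)) : iter l A ⊆ Metric.closedBall 0 r ∧
      ∀ z ∈ iter l A, ‖z‖ = r → z ∈ A ∧ ∀ u ∈ l, rf u z ∈ A := by
  induction l with
  | nil => exact ⟨hA, fun z hz _ => ⟨hz, by simp⟩⟩
  | cons u l ih =>
    obtain ⟨h1, h2⟩ := St_contact u ih.1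
    refine ⟨h1, fun z hz hr => ?_⟩
    obtain ⟨h3, h4⟩ := h2 z hz hr
    obtain ⟨h5, h6⟩ := ih.2 z h3 hr
    refine ⟨h5, ?_⟩
    intro v hv
    rcases List.mem_cons.1 hv with rfl | hv
    · exact (ih.2 _ h4 (by rw [LinearIsometryEquiv.norm_map]; exact hr)).1
    · exact h6 v hv

lemma exists_shrink {d : ℕ} (hd : 1 ≤ d) {A : Set (Eu d)} {r : ℝ} (hr : 0 ≤ r)
    (hA : IsCompact A) (hAc : Convex ℝ A) (hA0 : A.Nonempty) (hAr : A ⊆ Metric.closedBall 0 r)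
    (hne : A ≠ Metric.closedBall 0 r) :
    ∃ l : List (Eu d), ∃ r', 0 ≤ r' ∧ r' < r ∧ iter l A ⊆ Metric.closedBall 0 r' := by
  have : Nonempty (Fin d) := ⟨⟨0, hd⟩⟩
  have : Nontrivial (Eu d) := inferInstance
  have hz : ∃ z0 ∈ Metric.sphere (0 : Eu d) r, z0 ∉ A := by
    by_contra hcon
    push Not at hcon
    apply hne
    apply subset_antisymm hAr
    rw [← convexHull_sphere_eq_closedBall (0 : Eu d) hr]
    exact convexHull_min hcon hAc
  obtain ⟨z0, hz0, hz0A⟩ := hz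
  have hz0r : ‖z0‖ = r := by simpa using hz0
  obtain ⟨t, ht⟩ := (isCompact_sphere (0 : Eu d) r).elim_finite_subcover
    (fun u : Eu d => (rf u) ⁻¹' Aᶜ)
    (fun u => hA.isClosed.isOpen_compl.preimage (rf u).continuous) (by
      intro z hz
      have hzr : ‖z‖ = r := by simpa using hz
      refine mem_iUnion.2 ⟨z - z0, ?_⟩
      have : rf (z - z0) z = z0 := Submodule.reflection_sub (by rw [hzr, hz0r])
      show rf (z - z0) z ∉ A
      rw [this]
      exact hz0A)
  obtain ⟨h1, h2⟩ := iter_contact hAr t.toList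
  obtain ⟨c1, -, c3, -⟩ := iter_props hA hAc hA0 t.toList
  obtain ⟨y, hy, hmax⟩ := c1.exists_isMaxOn c3 (continuous_norm.continuousOn)
  refine ⟨t.toList, ‖y‖, norm_nonneg _, ?_, fun z hz => ?_⟩
  · have hyr := h1 hy
    rw [mem_closedBall_zero_iff] at hyr
    refine lt_of_le_of_ne hyr fun e => ?_
    have hys : y ∈ Metric.sphere (0 : Eu d) r := by simpa using e
    obtain ⟨u, hu, hyu⟩ := mem_iUnion₂.1 (ht hys)
    exact hyu ((h2 y hy e).2 u (Finset.mem_toList.2 hu))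
  · rw [mem_closedBall_zero_iff]
    exact hmax hz

/-- Lower semicontinuity of the volume on convex sets. -/
lemma vol_lsc {d : ℕ} {V : ENNReal} {C : Set (Eu d)} (hC : IsCompact C) (hCc : Convex ℝ C)
    (h : ∀ ε > 0, ∃ C' : Set (Eu d), IsClosed C' ∧ Convex ℝ C' ∧ volume C' ≤ V ∧
      ∀ c ∈ C, ∃ c' ∈ C', dist c c' ≤ ε) : volume C ≤ V := by
  rcases (interior C).eq_empty_or_nonempty with hi | ⟨p, hp⟩
  · have h0 : volume C = 0 := by
      have h1 := hCc.addHaar_frontier (volume : Measure (Eu d))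
      rw [frontier, hi, sdiff_empty] at h1
      exact measure_mono_null subset_closure h1
    rw [h0]
    exact zero_le
  obtain ⟨δ, hδ, hball⟩ : ∃ δ > 0, Metric.closedBall p δ ⊆ C :=
    Metric.nhds_basis_closedBall.mem_iff.1 (mem_interior_iff_mem_nhds.1 hp)
  have key : ∀ t : ℝ, 0 < t → t < 1 →
      ENNReal.ofReal (|(1 - t) ^ Module.finrank ℝ (Eu d)|) * volume C ≤ V := by
    intro t ht ht1
    obtain ⟨C', hcl, hco, hv, hap⟩ := h (t * δ) (by positivity)
    rw [← Measure.addHaar_image_homothety volume p]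
    refine (measure_mono ?_).trans hv
    rintro _ ⟨c, hc, rfl⟩
    by_contra hy
    set y := AffineMap.homothety p (1 - t) c with hydef
    have hy' : y = (1 - t) • c + t • p := by
      rw [hydef, AffineMap.homothety_apply]
      simp only [vsub_eq_sub, vadd_eq_add]
      module
    obtain ⟨f, s, hfs, hfy⟩ := geometric_hahn_banach_closed_point hco hcl hy
    set v := (InnerProductSpace.toDual ℝ (Eu d)).symm f with hv
    have hfv : ∀ x, f x = inner ℝ v x := by
      intro x
      rw [hv, InnerProductSpace.toDual_symm_apply]
    have hv0 : ‖v‖ ≠ 0 := by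
      intro h0
      have h0' : v = 0 := norm_eq_zero.1 h0
      obtain ⟨c', hc', -⟩ := hap c hc
      have e1 := hfs c' hc'
      rw [hfv, h0', inner_zero_left] at e1
      rw [hfv, h0', inner_zero_left] at hfy
      linarith
    have hvpos : 0 < ‖v‖ := lt_of_le_of_ne (norm_nonneg _) (Ne.symm hv0)
    have hq : p + (δ / ‖v‖) • v ∈ C := by
      apply hball
      rw [Metric.mem_closedBall, dist_eq_norm, add_sub_cancel_left, norm_smul, Real.norm_eq_abs,
        abs_of_pos (by positivity)]
      field_simp
      exact le_rfl
    have hq' : y + (t * δ / ‖v‖) • v ∈ C := by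
      have := hCc hc hq (show 0 ≤ 1 - t by linarith) ht.le (by ring)
      convert this using 1
      rw [hy']
      module
    obtain ⟨c', hc', hd⟩ := hap _ hq'
    have e1 := hfs c' hc'
    have e2 : f (y + (t * δ / ‖v‖) • v - c') ≤ ‖v‖ * (t * δ) := by
      rw [hfv]
      refine (real_inner_le_norm _ _).trans ?_
      rw [dist_eq_norm] at hd
      gcongr
    have e3 : f ((t * δ / ‖v‖) • v) = ‖v‖ * (t * δ) := by
      rw [hfv, inner_smul_right, real_inner_self_eq_norm_sq]
      field_simp
    rw [map_sub, map_add, e3] at e2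
    linarith
  have hlim : Filter.Tendsto
      (fun t : ℝ => ENNReal.ofReal (|(1 - t) ^ Module.finrank ℝ (Eu d)|) * volume C)
      (nhdsWithin 0 (Ioi 0)) (nhds (volume C)) := by
    have h1 : Filter.Tendsto
      (fun t : ℝ => ENNReal.ofReal (|(1 - t) ^ Module.finrank ℝ (Eu d)|))
      (nhds 0) (nhds (ENNReal.ofReal (|(1 - (0 : ℝ)) ^ Module.finrank ℝ (Eu d)|))) :=
      Continuous.tendsto (ENNReal.continuous_ofReal.comp (by fun_prop)) 0
    have h2 := ENNReal.Tendsto.mul_const (b := volume C) 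
      (h1.mono_left (nhdsWithin_le_nhds (s := Ioi (0 : ℝ))))
      (Or.inr hC.measure_lt_top.ne)
    simpa using h2
  refine le_of_tendsto hlim ?_
  filter_upwards [Ioo_mem_nhdsGT (show (0 : ℝ) < 1 by norm_num)] with t ht
  exact key t ht.1 ht.2

open TopologicalSpace

lemma near_of_dist {d : ℕ} {A B : NonemptyCompacts (Eu d)} {ε : ℝ} (h : dist A B < ε) :
    (∀ a ∈ A, ∃ b ∈ B, dist a b < ε) ∧ (∀ b ∈ B, ∃ a ∈ A, dist a b < ε) := by
  rw [Metric.NonemptyCompacts.dist_eq] at h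
  have fin : Metric.hausdorffEDist (A : Set (Eu d)) B ≠ ⊤ :=
    Metric.hausdorffEDist_ne_top_of_nonempty_of_bounded A.nonempty B.nonempty
      A.isCompact.isBounded B.isCompact.isBounded
  exact ⟨fun a ha => Metric.exists_dist_lt_of_hausdorffDist_lt ha h fin,
    fun b hb => Metric.exists_dist_lt_of_hausdorffDist_lt' hb h fin⟩

lemma convex_limit {d : ℕ} {A : NonemptyCompacts (Eu d)}
    (h : ∀ ε > 0, ∃ B : NonemptyCompacts (Eu d), dist A B < ε ∧ Convex ℝ (B : Set (Eu d))) :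
    Convex ℝ (A : Set (Eu d)) := by
  intro x hx y hy a b ha hb hab
  rw [← A.isCompact.isClosed.closure_eq, Metric.mem_closure_iff]
  intro ε hε
  obtain ⟨B, hAB, hB⟩ := h (ε / 2) (by positivity)
  obtain ⟨n1, n2⟩ := near_of_dist hAB
  obtain ⟨x', hx', dx⟩ := n1 x hx
  obtain ⟨y', hy', dy⟩ := n1 y hy
  obtain ⟨z, hz, dz⟩ := n2 _ (hB hx' hy' ha hb hab)
  refine ⟨z, hz, ?_⟩
  have : dist (a • x + b • y) (a • x' + b • y') ≤ ε / 2 := by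
    rw [dist_eq_norm] at dx dy ⊢
    rw [show a • x + b • y - (a • x' + b • y') = a • (x - x') + b • (y - y') by module]
    refine (norm_add_le _ _).trans ?_
    rw [norm_smul, norm_smul, Real.norm_of_nonneg ha, Real.norm_of_nonneg hb]
    nlinarith
  calc dist (a • x + b • y) z ≤ _ := dist_triangle _ (a • x' + b • y') _
    _ < ε := by rw [dist_comm _ z]; linarith

lemma vol_limit {d : ℕ} {v : ENNReal} {A : NonemptyCompacts (Eu d)}
    (h : ∀ ε > 0, ∃ B : NonemptyCompacts (Eu d), dist A B < ε ∧ v ≤ volume (B : Set (Eu d))) :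
    v ≤ volume (A : Set (Eu d)) := by
  have hl := (tendsto_measure_cthickening_of_isCompact (μ := volume) A.isCompact).mono_left
    (nhdsWithin_le_nhds (s := Ioi (0 : ℝ)))
  refine ge_of_tendsto hl ?_
  filter_upwards [self_mem_nhdsWithin] with ε hε
  obtain ⟨B, hAB, hB⟩ := h ε hε
  refine hB.trans (measure_mono fun b hb => ?_)
  obtain ⟨a, ha, hd⟩ := (near_of_dist hAB).2 b hb
  exact Metric.mem_cthickening_of_dist_le b a ε _ ha (by rw [dist_comm]; exact hd.le)

lemma good_limit {d : ℕ} {V : ENNReal} {A B : NonemptyCompacts (Eu d)}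
    (hAc : Convex ℝ (A : Set (Eu d))) (hBc : Convex ℝ (B : Set (Eu d)))
    (h : ∀ ε > 0, ∃ A' B' : NonemptyCompacts (Eu d), dist A A' < ε ∧ dist B B' < ε ∧
      Convex ℝ (A' : Set (Eu d)) ∧ Convex ℝ (B' : Set (Eu d)) ∧
      Good V (A' : Set (Eu d)) (B' : Set (Eu d))) :
    Good V (A : Set (Eu d)) (B : Set (Eu d)) := by
  rintro x ⟨z, hz, w, hw, hxw⟩
  have hxw : x + w = z := hxw
  refine vol_lsc (compact_hull A.isCompact (compact_vadd _ B.isCompact) hAc (hBc.vadd _)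
    A.nonempty (B.nonempty.vadd_set)) (convex_convexHull _ _) ?_
  intro ε hε
  obtain ⟨A', B', dA, dB, cA, cB, hg⟩ := h (ε / 3) (by positivity)
  have nA := (near_of_dist dA).1
  have nB := (near_of_dist dB).1
  obtain ⟨z', hz', dz⟩ := nA z hz
  obtain ⟨w', hw', dw⟩ := nB w hw
  set x' := z' - w' with hx'
  set C' := convexHull ℝ ((A' : Set (Eu d)) ∪ (x' +ᵥ (B' : Set (Eu d)))) with hC'
  have kC' : Convex ℝ C' := convex_convexHull _ _
  refine ⟨C', (compact_hull A'.isCompact (compact_vadd _ B'.isCompact) cA (cB.vadd _)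
    A'.nonempty (B'.nonempty.vadd_set)).isClosed, kC',
    hg x' ⟨z', hz', w', hw', by simp [hx']⟩, ?_⟩
  have hconv : Convex ℝ {c | ∃ c' ∈ C', dist c c' ≤ ε} := by
    rintro c ⟨c', hc', dc⟩ e ⟨e', he', de⟩ a b ha hb hab
    refine ⟨_, kC' hc' he' ha hb hab, ?_⟩
    rw [dist_eq_norm] at dc de ⊢
    rw [show a • c + b • e - (a • c' + b • e') = a • (c - c') + b • (e - e') by module]
    refine (norm_add_le _ _).trans ?_
    rw [norm_smul, norm_smul, Real.norm_of_nonneg ha, Real.norm_of_nonneg hb]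
    nlinarith
  refine convexHull_min ?_ hconv
  rintro c (hc | ⟨b, hb, rfl⟩)
  · obtain ⟨c', hc', dc⟩ := nA c hc
    exact ⟨c', subset_convexHull _ _ (Or.inl hc'), by linarith⟩
  · obtain ⟨b', hb', db⟩ := nB b hb
    refine ⟨x' + b', subset_convexHull _ _ (Or.inr ⟨b', hb', rfl⟩), ?_⟩
    show dist (x + b) (x' + b') ≤ ε
    have e : x = z - w := by rw [← hxw]; simp
    rw [dist_eq_norm] at dz dw db ⊢
    rw [e, hx', show z - w + b - (z' - w' + b') = (z - z') - (w - w') + (b - b') by abel]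
    refine (norm_add_le _ _).trans ?_
    have := norm_sub_le (z - z') (w - w')
    linarith

/-- The class of admissible pairs. -/
def Cls {d : ℕ} (V a b : ENNReal) (R : ℝ) :
    Set (NonemptyCompacts (Eu d) × NonemptyCompacts (Eu d)) :=
  {p | ((p.1 : Set (Eu d)) ⊆ Metric.closedBall 0 R ∧ (p.2 : Set (Eu d)) ⊆ Metric.closedBall 0 R) ∧
    (Convex ℝ (p.1 : Set (Eu d)) ∧ Convex ℝ (p.2 : Set (Eu d))) ∧
    (a ≤ volume (p.1 : Set (Eu d)) ∧ b ≤ volume (p.2 : Set (Eu d))) ∧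
    Good V (p.1 : Set (Eu d)) (p.2 : Set (Eu d))}

lemma Cls_compact {d : ℕ} (V a b : ENNReal) (R : ℝ) : IsCompact (Cls (d := d) V a b R) := by
  have hT := NonemptyCompacts.isCompact_subsets_of_isCompact
    (isCompact_closedBall (0 : Eu d) R)
  refine (hT.prod hT).of_isClosed_subset ?_ (fun p hp => hp.1)
  refine isClosed_of_closure_subset fun p hp => ?_
  have hsub : (p.1 : Set (Eu d)) ⊆ Metric.closedBall 0 R ∧
      (p.2 : Set (Eu d)) ⊆ Metric.closedBall 0 R :=
    closure_minimal (fun p (hp : p ∈ Cls V a b R) => hp.1) (hT.prod hT).isClosed hp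
  rw [Metric.mem_closure_iff] at hp
  have hp' : ∀ ε > 0, ∃ q ∈ Cls (d := d) V a b R, dist p.1 q.1 < ε ∧ dist p.2 q.2 < ε := by
    intro ε hε
    obtain ⟨q, hq, hd⟩ := hp ε hε
    rw [Prod.dist_eq] at hd
    exact ⟨q, hq, (le_max_left _ _).trans_lt hd, (le_max_right _ _).trans_lt hd⟩
  have c1 : Convex ℝ (p.1 : Set (Eu d)) := convex_limit fun ε hε => by
    obtain ⟨q, hq, h1, h2⟩ := hp' ε hε
    exact ⟨q.1, h1, hq.2.1.1⟩
  have c2 : Convex ℝ (p.2 : Set (Eu d)) := convex_limit fun ε hε => by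
    obtain ⟨q, hq, h1, h2⟩ := hp' ε hε
    exact ⟨q.2, h2, hq.2.1.2⟩
  refine ⟨hsub, ⟨c1, c2⟩, ⟨vol_limit fun ε hε => ?_, vol_limit fun ε hε => ?_⟩,
    good_limit c1 c2 fun ε hε => ?_⟩
  · obtain ⟨q, hq, h1, h2⟩ := hp' ε hε
    exact ⟨q.1, h1, hq.2.2.1.1⟩
  · obtain ⟨q, hq, h1, h2⟩ := hp' ε hε
    exact ⟨q.2, h2, hq.2.2.1.2⟩
  · obtain ⟨q, hq, h1, h2⟩ := hp' ε hε
    exact ⟨q.1, q.2, h1, h2, hq.2.1.1, hq.2.1.2, hq.2.2.2⟩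

lemma dist_zero_le {d : ℕ} {A : NonemptyCompacts (Eu d)} {r : ℝ} (hr : 0 ≤ r)
    (h : (A : Set (Eu d)) ⊆ Metric.closedBall 0 r) : dist A {0} ≤ r := by
  rw [Metric.NonemptyCompacts.dist_eq]
  refine Metric.hausdorffDist_le_of_mem_dist hr (fun x hx => ⟨0, by simp, h hx⟩) ?_
  intro y hy
  obtain ⟨x, hx⟩ := A.nonempty
  have : y = 0 := by simpa using hy
  subst this
  exact ⟨x, hx, by rw [dist_comm]; exact h hx⟩

lemma subset_dist_zero {d : ℕ} (A : NonemptyCompacts (Eu d)) :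
    (A : Set (Eu d)) ⊆ Metric.closedBall 0 (dist A {0}) := by
  intro x hx
  rw [Metric.mem_closedBall]
  refine le_of_forall_pos_lt_add fun ε hε => ?_
  obtain ⟨y, hy, h⟩ := (near_of_dist (show dist A {0} < dist A {0} + ε by linarith)).1 x hx
  have : y = 0 := by simpa using hy
  subst this
  exact h

/-- `iter` as an operation on nonempty compacts, on a member of the class. -/
lemma Cls_iter {d : ℕ} {V a b : ENNReal} {R : ℝ}
    {p : NonemptyCompacts (Eu d) × NonemptyCompacts (Eu d)} (hp : p ∈ Cls V a b R)
    (l : List (Eu d)) : ∃ q ∈ Cls (d := d) V a b R, (q.1 : Set (Eu d)) = iter l p.1 ∧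
      (q.2 : Set (Eu d)) = iter l p.2 := by
  obtain ⟨⟨s1, s2⟩, ⟨c1, c2⟩, ⟨v1, v2⟩, hg⟩ := hp
  obtain ⟨h1, h2, h3, h4⟩ := iter_props p.1.isCompact c1 p.1.nonempty l
  obtain ⟨g1, g2, g3, g4⟩ := iter_props p.2.isCompact c2 p.2.nonempty l
  refine ⟨(⟨⟨iter l p.1, h1⟩, h3⟩, ⟨⟨iter l p.2, g1⟩, g3⟩), ?_, rfl, rfl⟩
  exact ⟨⟨(iter_contact s1 l).1, (iter_contact s2 l).1⟩, ⟨h2, g2⟩,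
    ⟨v1.trans_eq h4.symm, v2.trans_eq g4.symm⟩,
    iter_good p.1.isCompact c1 p.1.nonempty p.2.isCompact c2 p.2.nonempty hg l⟩

lemma exists_balls {d : ℕ} (hd : 1 ≤ d) {V a b : ENNReal} {R : ℝ}
    (hne : (Cls (d := d) V a b R).Nonempty) :
    ∃ r s : ℝ, 0 ≤ r ∧ 0 ≤ s ∧ a ≤ volume (Metric.closedBall (0 : Eu d) r) ∧
      b ≤ volume (Metric.closedBall (0 : Eu d) s) ∧
      Good V (Metric.closedBall (0 : Eu d) r) (Metric.closedBall (0 : Eu d) s) := by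
  obtain ⟨p, hp, hmin⟩ := (Cls_compact V a b R).exists_isMinOn hne
    (f := fun p => dist p.1 {0} + dist p.2 {0}) (by fun_prop)
  have i1 := subset_dist_zero p.1
  have i2 := subset_dist_zero p.2
  have e1 : (p.1 : Set (Eu d)) = Metric.closedBall 0 (dist p.1 {0}) := by
    by_contra hcon
    obtain ⟨l, r', hr', hlt, hsub⟩ := exists_shrink hd dist_nonneg p.1.isCompact hp.2.1.1
      p.1.nonempty i1 hcon
    obtain ⟨q, hq, q1, q2⟩ := Cls_iter hp l
    have m : dist p.1 {0} + dist p.2 {0} ≤ dist q.1 {0} + dist q.2 {0} := hmin hq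
    have k1 : dist q.1 {0} ≤ r' := dist_zero_le hr' (q1 ▸ hsub)
    have k2 : dist q.2 {0} ≤ dist p.2 {0} :=
      dist_zero_le dist_nonneg (q2 ▸ (iter_contact i2 l).1)
    linarith
  have e2 : (p.2 : Set (Eu d)) = Metric.closedBall 0 (dist p.2 {0}) := by
    by_contra hcon
    obtain ⟨l, r', hr', hlt, hsub⟩ := exists_shrink hd dist_nonneg p.2.isCompact hp.2.1.2
      p.2.nonempty i2 hcon
    obtain ⟨q, hq, q1, q2⟩ := Cls_iter hp l
    have m : dist p.1 {0} + dist p.2 {0} ≤ dist q.1 {0} + dist q.2 {0} := hmin hq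
    have k1 : dist q.2 {0} ≤ r' := dist_zero_le hr' (q2 ▸ hsub)
    have k2 : dist q.1 {0} ≤ dist p.1 {0} :=
      dist_zero_le dist_nonneg (q1 ▸ (iter_contact i1 l).1)
    linarith
  obtain ⟨-, -, ⟨v1, v2⟩, hg⟩ := hp
  rw [e1] at v1 hg
  rw [e2] at v2 hg
  exact ⟨_, _, dist_nonneg, dist_nonneg, v1, v2, hg⟩

lemma Good.mono {d : ℕ} {V : ENNReal} {A B A' B' : Set (Eu d)} (h : Good V A B)
    (hA : A' ⊆ A) (hB : B' ⊆ B) : Good V A' B' := by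
  intro x hx
  have hB' : x +ᵥ B' ⊆ x +ᵥ B := vadd_set_mono hB
  exact (measure_mono (convexHull_mono (union_subset_union hA hB'))).trans
    (h x (hx.mono (inter_subset_inter hA hB')))

lemma radius_le {d : ℕ} (hd : 1 ≤ d) {r s : ℝ} (hr : 0 ≤ r) (hs : 0 ≤ s)
    (h : volume (Metric.closedBall (0 : Eu d) r) ≤ volume (Metric.closedBall (0 : Eu d) s)) :
    r ≤ s := by
  rw [Measure.addHaar_closedBall _ _ hr, Measure.addHaar_closedBall _ _ hs,
    ENNReal.mul_le_mul_iff_left (Metric.measure_ball_pos _ _ one_pos).ne'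
      measure_ball_lt_top.ne, ENNReal.ofReal_le_ofReal_iff (by positivity)] at h
  exact le_of_pow_le_pow_left₀ (by simp; omega) hs h

end RS

/-- Rogers–Shephard: replacing two convex bodies `H`, `K` by balls `S_H`, `S_K` of the same
volumes does not increase the maximal volume of the convex hull of a meeting pair of
translates: `V*(H,K) ≥ V*(S_H, S_K)`. -/
theorem maxHullVol_ge_of_balls (d : ℕ) (hd : 1 ≤ d)
    (H K : Set (EuclideanSpace ℝ (Fin d)))
    (hHc : IsCompact H) (hHconv : Convex ℝ H) (hHne : H.Nonempty)
    (hKc : IsCompact K) (hKconv : Convex ℝ K) (hKne : K.Nonempty)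
    (rH rK : ℝ) (hrH : 0 ≤ rH) (hrK : 0 ≤ rK)
    (hvH : volume (Metric.closedBall (0 : EuclideanSpace ℝ (Fin d)) rH) = volume H)
    (hvK : volume (Metric.closedBall (0 : EuclideanSpace ℝ (Fin d)) rK) = volume K) :
    maxHullVol H K ≥ maxHullVol (d := d) (Metric.closedBall 0 rH) (Metric.closedBall 0 rK) := by
  obtain ⟨R, hR⟩ := (hHc.union hKc).isBounded.subset_closedBall 0
  have hHR : H ⊆ Metric.closedBall 0 R := Set.subset_union_left.trans hR
  have hKR : K ⊆ Metric.closedBall 0 R := Set.subset_union_right.trans hR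
  have hbound : ∀ x : EuclideanSpace ℝ (Fin d), (H ∩ (x +ᵥ K)).Nonempty →
      convexHull ℝ (H ∪ (x +ᵥ K)) ⊆ Metric.closedBall 0 (3 * R) := by
    rintro x ⟨z, hz, w, hw, hxw⟩
    have hxw : x + w = z := hxw
    have h1 := hHR hz
    have h2 := hKR hw
    rw [mem_closedBall_zero_iff] at h1 h2
    have hx : ‖x‖ ≤ 2 * R := by
      rw [show x = z - w by rw [← hxw]; simp]
      exact (norm_sub_le _ _).trans (by linarith)
    have hR0 : 0 ≤ R := (norm_nonneg _).trans h1
    refine convexHull_min ?_ (convex_closedBall _ _)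
    rintro y (hy | ⟨k, hk, rfl⟩)
    · have h3 := hHR hy
      rw [mem_closedBall_zero_iff] at h3 ⊢
      linarith
    · have h3 := hKR hk
      rw [mem_closedBall_zero_iff] at h3 ⊢
      exact (norm_add_le _ _).trans (by linarith)
  have hfin : volume (Metric.closedBall (0 : EuclideanSpace ℝ (Fin d)) (3 * R)) ≠ ⊤ :=
    Metric.isBounded_closedBall.measure_lt_top.ne
  have hgood : RS.Good (ENNReal.ofReal (maxHullVol H K)) H K := by
    intro x hx
    have hm := measure_mono (μ := volume) (hbound x hx)
    rw [ENNReal.le_ofReal_iff_toReal_le (ne_top_of_le_ne_top hfin hm)]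
    · refine le_csSup
        ⟨(volume (Metric.closedBall (0 : EuclideanSpace ℝ (Fin d)) (3 * R))).toReal, ?_⟩ ⟨x, hx, rfl⟩
      rintro v ⟨y, hy, rfl⟩
      exact ENNReal.toReal_mono hfin (measure_mono (hbound y hy))
    · refine Real.sSup_nonneg ?_
      rintro v ⟨y, hy, rfl⟩
      exact ENNReal.toReal_nonneg
  have hne : (RS.Cls (d := d) (ENNReal.ofReal (maxHullVol H K)) (volume H) (volume K) R).Nonempty :=
    ⟨(⟨⟨H, hHc⟩, hHne⟩, ⟨⟨K, hKc⟩, hKne⟩), ⟨hHR, hKR⟩, ⟨hHconv, hKconv⟩, ⟨le_rfl, le_rfl⟩, hgood⟩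
  obtain ⟨r, s, hr, hs, vr, vs, hg⟩ := RS.exists_balls hd hne
  rw [← hvH] at vr
  rw [← hvK] at vs
  have g := hg.mono (Metric.closedBall_subset_closedBall (RS.radius_le hd hrH hr vr))
    (Metric.closedBall_subset_closedBall (RS.radius_le hd hrK hs vs))
  have hV0 : 0 ≤ maxHullVol H K := by
    refine Real.sSup_nonneg ?_
    rintro v ⟨y, hy, rfl⟩
    exact ENNReal.toReal_nonneg
  refine Real.sSup_le ?_ hV0
  rintro v ⟨y, hy, rfl⟩
  exact ENNReal.toReal_le_of_le_ofReal hV0 (g y hy)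
end
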